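/- arXiv:0706.2778 — 2 statements merged into one kernel-verified Lean document; each statement's English description precedes it below -/
import Mathlib

section
/- For every n ≥ 1 and every (n+1)-cycle c in the symmetric group S_{n+1}, the number of maximal chains in the interval [1,c] of the absolute order equals (n+1)^{n−1}. Equivalently, the number of sequences (t₁,…,t_n) of transpositions in S_{n+1} with t₁t₂⋯t_n = c equals (n+1)^{n−1}. -/
open scoped BigOperators

section Defs

variable {G : Type*} [Group G]

/-- `t` is a reflection with respect to the generating set `S`:
a conjugate of an element of `S`. -/
def IsReflectionOf (S : Set G) (t : G) : Prop :=
  ∃ g : G, ∃ s ∈ S, t = g * s * g⁻¹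

/-- The absolute length of `w`: the minimal length of a word in the
reflections (conjugates of elements of `S`) whose product is `w`. -/
noncomputable def absLength (S : Set G) (w : G) : ℕ :=
  sInf {k | ∃ l : List G, (∀ t ∈ l, IsReflectionOf S t) ∧ l.length = k ∧ l.prod = w}

/-- The absolute order: `u ≤ v` iff `ℓ_T(u) + ℓ_T(u⁻¹v) = ℓ_T(v)`. -/
def absLe (S : Set G) (u v : G) : Prop :=
  absLength S u + absLength S (u⁻¹ * v) = absLength S v

/-- `c` is a Coxeter element with respect to the set `S` of simple reflections:
a product of all the elements of `S`, each occurring exactly once, in some order. -/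
def IsCoxeterElementOf (S : Set G) (c : G) : Prop :=
  ∃ l : List G, l.Nodup ∧ (∀ x, x ∈ l ↔ x ∈ S) ∧ l.prod = c

/-- The rank-selected multichain count `C_{(j₁,…,j_m)}(W)`: the number of multichains
`x₁ ≤ ⋯ ≤ x_{m-1}` in the interval `[1,c]` of the absolute order whose sequence of
rank jumps (prepending `1` and appending `c`) is given by `j`. -/
noncomputable def chainCount (S : Set G) (c : G) {m : ℕ} (j : Fin m → ℕ) : ℕ :=
  Nat.card {y : Fin (m + 1) → G //
    y 0 = 1 ∧ y (Fin.last m) = c ∧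
    (∀ i, absLe S (y i) c) ∧
    (∀ i : Fin m, absLe S (y i.castSucc) (y i.succ)) ∧
    (∀ i : Fin m, absLength S (y i.succ) = absLength S (y i.castSucc) + j i)}

end Defs

section Cox

variable {B : Type*} {W : Type*} [Group W] {M : CoxeterMatrix B}

/-- The set of simple reflections of a Coxeter system. -/
def simpleSet (cs : CoxeterSystem M W) : Set W := Set.range cs.simple

/-- A Coxeter system is irreducible if its set of simple reflections is nonempty and cannot
be partitioned into two nonempty subsets such that every simple reflection in one commutes
with every simple reflection in the other. -/
def IsIrreducibleCS (cs : CoxeterSystem M W) : Prop :=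
  Nonempty B ∧
    ∀ A : Set B, (∀ a ∈ A, ∀ b ∈ Aᶜ, Commute (cs.simple a) (cs.simple b)) →
      A = ∅ ∨ A = Set.univ

/-- The standard parabolic subgroup `W_⟨s⟩` generated by the simple reflections
other than `cs.simple s`. -/
def parabolic (cs : CoxeterSystem M W) (s : B) : Subgroup W :=
  Subgroup.closure (Set.range cs.simple \ {cs.simple s})

/-- The set of simple reflections of the parabolic subgroup `W_⟨s⟩`, viewed as
elements of that subgroup. -/
def parabolicGens (cs : CoxeterSystem M W) (s : B) : Set (parabolic cs s) :=
  {x | (x : W) ∈ Set.range cs.simple \ {cs.simple s}}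

end Cox

section MaxChains

variable {G : Type*} [Group G]

/-- The number of maximal chains `1 = x₀ < x₁ < ⋯ < x_n = c` (with `ℓ_T(x_i) = i` for
all `i`) in the noncrossing partition lattice `[1,c]` in the absolute order. -/
noncomputable def maxChainCount (S : Set G) (c : G) (n : ℕ) : ℕ :=
  Nat.card {y : Fin (n + 1) → G //
    y 0 = 1 ∧ y (Fin.last n) = c ∧
    (∀ i : Fin n, absLe S (y i.castSucc) (y i.succ)) ∧
    (∀ i : Fin (n + 1), absLength S (y i) = (i : ℕ))}

end MaxChains


namespace MinimalFactorization

open Equiv Equiv.Perm Finset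

section SwapMul

variable {α : Type*} [DecidableEq α]

/-- Multiplying by `swap a b` only relates points of the same cycle or points of the two cycles
through `a` and `b`. -/
theorem sameCycle_of_sameCycle_swap_mul [Finite α] {π : Perm α} {a b x y : α}
    (h : SameCycle (swap a b * π) x y) :
    SameCycle π x y ∨
      (SameCycle π a x ∨ SameCycle π b x) ∧ (SameCycle π a y ∨ SameCycle π b y) := by
  obtain ⟨k, rfl⟩ := h.exists_nat_pow_eq
  clear h
  induction k with
  | zero => exact .inl (SameCycle.refl π x)
  | succ k ih =>
    rw [pow_succ', Perm.mul_apply, Perm.mul_apply]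
    set z := ((swap a b * π) ^ k) x
    have hz : SameCycle π z (π z) := sameCycle_apply_right.2 (SameCycle.refl π z)
    have key : ∀ w, SameCycle π z w → SameCycle π x w ∨
        (SameCycle π a x ∨ SameCycle π b x) ∧ (SameCycle π a w ∨ SameCycle π b w) := by
      intro w hw
      rcases ih with ih | ⟨h1, h2 | h2⟩
      · exact .inl (ih.trans hw)
      · exact .inr ⟨h1, .inl (h2.trans hw)⟩
      · exact .inr ⟨h1, .inr (h2.trans hw)⟩
    rcases eq_or_ne (π z) a with ha | ha
    · rw [ha, swap_apply_left]
      rcases key a (ha ▸ hz) with h | ⟨h, -⟩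
      · exact .inr ⟨.inl h.symm, .inr (SameCycle.refl π b)⟩
      · exact .inr ⟨h, .inr (SameCycle.refl π b)⟩
    rcases eq_or_ne (π z) b with hb | hb
    · rw [hb, swap_apply_right]
      rcases key b (hb ▸ hz) with h | ⟨h, -⟩
      · exact .inr ⟨.inr h.symm, .inl (SameCycle.refl π a)⟩
      · exact .inr ⟨h, .inl (SameCycle.refl π a)⟩
    · rw [swap_apply_of_ne_of_ne ha hb]
      exact key _ hz

theorem sameCycle_swap_mul_self [Finite α] {π : Perm α} {a b : α} (hab : ¬SameCycle π a b) :
    SameCycle (swap a b * π) a b := by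
  have key : ∀ j : ℕ, ((swap a b * π) ^ j) a = (π ^ j) a ∨ SameCycle (swap a b * π) a b := by
    intro j
    induction j with
    | zero => exact .inl rfl
    | succ j ih =>
      rcases ih with ih | ih
      · rcases eq_or_ne ((π ^ (j + 1)) a) a with ha | ha
        · refine .inr ⟨(j + 1 : ℕ), ?_⟩
          rw [zpow_natCast, pow_succ', Perm.mul_apply, ih, Perm.mul_apply, ← Perm.mul_apply π,
            ← pow_succ', ha, swap_apply_left]
        · left
          rw [pow_succ', Perm.mul_apply, ih, Perm.mul_apply, ← Perm.mul_apply π, ← pow_succ']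
          refine swap_apply_of_ne_of_ne ha fun hb => hab ⟨(j + 1 : ℕ), ?_⟩
          rw [zpow_natCast, hb]
      · exact .inr ih
  cases nonempty_fintype α
  obtain ⟨j, hj⟩ := Nat.exists_eq_succ_of_ne_zero (orderOf_pos π).ne'
  rcases key j with h | h
  · refine ⟨(j + 1 : ℕ), ?_⟩
    rw [zpow_natCast, pow_succ', Perm.mul_apply, h, Perm.mul_apply, ← Perm.mul_apply π,
      ← pow_succ', ← Nat.succ_eq_add_one, ← hj, pow_orderOf_eq_one, Perm.one_apply,
      swap_apply_left]
  · exact h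

/-- If `a` and `b` lie in different cycles of `π`, multiplying by `swap a b` merges these cycles
and leaves the others unchanged. -/
theorem sameCycle_swap_mul_iff [Finite α] {π : Perm α} {a b x y : α} (hab : ¬SameCycle π a b) :
    SameCycle (swap a b * π) x y ↔ SameCycle π x y ∨
      (SameCycle π a x ∨ SameCycle π b x) ∧ (SameCycle π a y ∨ SameCycle π b y) := by
  refine ⟨sameCycle_of_sameCycle_swap_mul, fun h => ?_⟩
  have hab' := sameCycle_swap_mul_self hab
  have up : ∀ {u v}, SameCycle π u v → SameCycle (swap a b * π) u v := by
    intro u v huv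
    have hπ : π = swap a b * (swap a b * π) := by rw [swap_mul_self_mul]
    rw [hπ] at huv
    rcases sameCycle_of_sameCycle_swap_mul huv with h | ⟨h1 | h1, h2 | h2⟩
    · exact h
    · exact h1.symm.trans h2
    · exact h1.symm.trans (hab'.trans h2)
    · exact h1.symm.trans (hab'.symm.trans h2)
    · exact h1.symm.trans h2
  rcases h with h | ⟨h1 | h1, h2 | h2⟩
  · exact up h
  · exact (up h1).symm.trans (up h2)
  · exact (up h1).symm.trans (hab'.trans (up h2))
  · exact (up h1).symm.trans (hab'.symm.trans (up h2))
  · exact (up h1).symm.trans (up h2)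

theorem sameCycle_of_sameCycle_swap_mul_of_sameCycle [Finite α] {π : Perm α} {a b x y : α}
    (hab : SameCycle π a b) (h : SameCycle (swap a b * π) x y) : SameCycle π x y := by
  rcases sameCycle_of_sameCycle_swap_mul h with h | ⟨h1 | h1, h2 | h2⟩
  · exact h
  · exact h1.symm.trans h2
  · exact h1.symm.trans (hab.trans h2)
  · exact h1.symm.trans (hab.symm.trans h2)
  · exact h1.symm.trans h2

end SwapMul

section Orbits

variable {α : Type*} [DecidableEq α] [Fintype α]

/-- The orbit of `a` under the permutation `π`. -/
def orbitOf (π : Perm α) (a : α) : Finset α := {x | SameCycle π a x}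

/-- The orbits of a permutation, fixed points included. -/
def orbits (π : Perm α) : Finset (Finset α) := univ.image (orbitOf π)

@[simp] theorem mem_orbitOf {π : Perm α} {a x : α} : x ∈ orbitOf π a ↔ SameCycle π a x := by
  simp [orbitOf]

theorem orbitOf_mem_orbits (π : Perm α) (a : α) : orbitOf π a ∈ orbits π :=
  mem_image_of_mem _ (mem_univ a)

theorem orbitOf_eq_iff {π : Perm α} {a b : α} : orbitOf π a = orbitOf π b ↔ SameCycle π a b := by
  refine ⟨fun h => ?_, fun h => ?_⟩
  · rw [← mem_orbitOf, h, mem_orbitOf]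
  · ext x
    rw [mem_orbitOf, mem_orbitOf]
    exact ⟨h.symm.trans, h.trans⟩

theorem card_orbitOf_pos (π : Perm α) (a : α) : 0 < #(orbitOf π a) :=
  card_pos.2 ⟨a, mem_orbitOf.2 (SameCycle.refl π a)⟩

theorem orbitOf_swap_mul {π : Perm α} {a b : α} (hab : ¬SameCycle π a b) (x : α) :
    orbitOf (swap a b * π) x = if SameCycle π a x ∨ SameCycle π b x
      then orbitOf π a ∪ orbitOf π b else orbitOf π x := by
  ext y
  rw [mem_orbitOf, sameCycle_swap_mul_iff hab]
  split_ifs with h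
  · simp only [mem_union, mem_orbitOf, h, true_and, or_iff_right_iff_imp]
    exact fun hxy => h.imp (·.trans hxy) (·.trans hxy)
  · simp [h]

theorem orbits_swap_mul {π : Perm α} {a b : α} (hab : ¬SameCycle π a b) :
    orbits (swap a b * π) = insert (orbitOf π a ∪ orbitOf π b)
      (((orbits π).erase (orbitOf π a)).erase (orbitOf π b)) := by
  ext B
  simp only [orbits, mem_image, mem_univ, true_and, mem_insert, mem_erase, orbitOf_swap_mul hab]
  constructor
  · rintro ⟨x, rfl⟩
    split_ifs with h
    · exact .inl rfl
    · rw [not_or] at h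
      refine .inr ⟨fun e => h.2 (orbitOf_eq_iff.1 e).symm, fun e => h.1 (orbitOf_eq_iff.1 e).symm,
        x, rfl⟩
  · rintro (rfl | ⟨h1, h2, x, rfl⟩)
    · exact ⟨a, if_pos (.inl (SameCycle.refl π a))⟩
    · refine ⟨x, if_neg ?_⟩
      rintro (h | h)
      · exact h2 (orbitOf_eq_iff.2 h.symm)
      · exact h1 (orbitOf_eq_iff.2 h.symm)

theorem union_notMem_erase_orbits (π : Perm α) (a b : α) :
    orbitOf π a ∪ orbitOf π b ∉ ((orbits π).erase (orbitOf π a)).erase (orbitOf π b) := by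
  simp only [orbits, mem_erase, mem_image, mem_univ, true_and, not_and, not_exists]
  intro _ h x hx
  apply h
  rw [← hx, orbitOf_eq_iff, ← mem_orbitOf, hx]
  exact mem_union_left _ (mem_orbitOf.2 (SameCycle.refl π a))

theorem card_orbits_swap_mul {π : Perm α} {a b : α} (hab : ¬SameCycle π a b) :
    #(orbits (swap a b * π)) + 1 = #(orbits π) := by
  have hne : orbitOf π b ≠ orbitOf π a := fun e => hab (orbitOf_eq_iff.1 e.symm)
  rw [orbits_swap_mul hab, card_insert_of_notMem (union_notMem_erase_orbits π a b),
    card_erase_add_one (mem_erase.2 ⟨hne, orbitOf_mem_orbits π b⟩),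
    card_erase_add_one (orbitOf_mem_orbits π a)]

theorem card_orbits_le_of_sameCycle {π : Perm α} {a b : α} (hab : SameCycle π a b) :
    #(orbits π) ≤ #(orbits (swap a b * π)) := by
  have : orbits π = (orbits (swap a b * π)).image (fun B => B.biUnion (orbitOf π)) := by
    rw [orbits, orbits, image_image]
    refine image_congr fun x _ => ?_
    ext y
    simp only [mem_orbitOf, Function.comp_apply, mem_biUnion]
    exact ⟨fun h => ⟨x, SameCycle.refl _ x, h⟩, fun ⟨z, hz, hzy⟩ =>
      (sameCycle_of_sameCycle_swap_mul_of_sameCycle hab hz).trans hzy⟩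
  rw [this]
  exact card_image_le

theorem card_orbits_le_swap_mul_add_one (π : Perm α) (a b : α) :
    #(orbits π) ≤ #(orbits (swap a b * π)) + 1 := by
  by_cases hab : SameCycle π a b
  · exact (card_orbits_le_of_sameCycle hab).trans (Nat.le_succ _)
  · exact (card_orbits_swap_mul hab).ge

theorem card_orbits_one : #(orbits (1 : Perm α)) = Fintype.card α := by
  rw [orbits, card_image_of_injective, card_univ]
  intro a b h
  exact sameCycle_one.1 (orbitOf_eq_iff.1 h)

theorem prod_card_orbits_one : ∏ B ∈ orbits (1 : Perm α), (#B : ℚ) = 1 := by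
  refine prod_eq_one fun B hB => ?_
  obtain ⟨a, -, rfl⟩ := mem_image.1 hB
  have : orbitOf (1 : Perm α) a = {a} := by
    ext x; simp [eq_comm]
  simp [this]

/-- A product of `k` transpositions has at least `#α - k` orbits. -/
theorem card_le_card_orbits_prod_add_length (l : List (Perm α)) (hl : ∀ t ∈ l, t.IsSwap) :
    Fintype.card α ≤ #(orbits l.prod) + l.length := by
  induction l with
  | nil => simp [card_orbits_one]
  | cons t l ih =>
    have h1 := ih fun s hs => hl s (List.mem_cons_of_mem _ hs)
    obtain ⟨a, b, -, rfl⟩ := hl t List.mem_cons_self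
    have h2 := card_orbits_le_swap_mul_add_one l.prod a b
    rw [List.prod_cons, List.length_cons]
    lia

theorem prod_card_orbits_swap_mul {π : Perm α} {a b : α} (hab : ¬SameCycle π a b) :
    ∏ B ∈ orbits (swap a b * π), (#B : ℚ) =
      (∏ B ∈ orbits π, (#B : ℚ)) * ((#(orbitOf π a) : ℚ)⁻¹ + (#(orbitOf π b) : ℚ)⁻¹) := by
  have hne : orbitOf π b ≠ orbitOf π a := fun e => hab (orbitOf_eq_iff.1 e.symm)
  have hdisj : Disjoint (orbitOf π a) (orbitOf π b) := by
    refine disjoint_left.2 fun x hx hy => hab ?_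
    exact (mem_orbitOf.1 hx).trans (mem_orbitOf.1 hy).symm
  rw [orbits_swap_mul hab, prod_insert (union_notMem_erase_orbits π a b),
    card_union_of_disjoint hdisj, ← mul_prod_erase _ _ (orbitOf_mem_orbits π a),
    ← mul_prod_erase _ _ (mem_erase.2 ⟨hne, orbitOf_mem_orbits π b⟩)]
  have ha : (#(orbitOf π a) : ℚ) ≠ 0 := by exact_mod_cast (card_orbitOf_pos π a).ne'
  have hb : (#(orbitOf π b) : ℚ) ≠ 0 := by exact_mod_cast (card_orbitOf_pos π b).ne'
  push_cast
  field_simp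
  ring

theorem sum_inv_card_orbitOf (π : Perm α) :
    ∑ a, (#(orbitOf π a) : ℚ)⁻¹ = #(orbits π) := by
  rw [sum_comp (fun B : Finset α => (#B : ℚ)⁻¹) (orbitOf π), card_eq_sum_ones, Nat.cast_sum]
  refine sum_congr rfl fun B hB => ?_
  obtain ⟨a, -, rfl⟩ := mem_image.1 hB
  have : ({x ∈ univ | orbitOf π x = orbitOf π a} : Finset α) = orbitOf π a := by
    ext x
    simp [orbitOf_eq_iff, sameCycle_comm]
  have ha : (#(orbitOf π a) : ℚ) ≠ 0 := by exact_mod_cast (card_orbitOf_pos π a).ne'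
  rw [this, nsmul_eq_mul, mul_inv_cancel₀ ha, Nat.cast_one]

theorem sum_sum_not_sameCycle_inv (π : Perm α) :
    ∑ a, ∑ b, (if SameCycle π a b then 0 else (#(orbitOf π a) : ℚ)⁻¹) =
      Fintype.card α * (#(orbits π) - 1) := by
  have h : ∀ a, ∑ b, (if SameCycle π a b then 0 else (#(orbitOf π a) : ℚ)⁻¹) =
      Fintype.card α * (#(orbitOf π a) : ℚ)⁻¹ - 1 := by
    intro a
    have ha : (#(orbitOf π a) : ℚ) ≠ 0 := by exact_mod_cast (card_orbitOf_pos π a).ne'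
    have : ∀ b, (if SameCycle π a b then 0 else (#(orbitOf π a) : ℚ)⁻¹) =
        (#(orbitOf π a) : ℚ)⁻¹ - if SameCycle π a b then (#(orbitOf π a) : ℚ)⁻¹ else 0 := by
      intro b; split_ifs <;> simp
    rw [sum_congr rfl fun b _ => this b, sum_sub_distrib, ← sum_filter, sum_const, sum_const,
      card_univ, nsmul_eq_mul, nsmul_eq_mul]
    change _ - (#(orbitOf π a) : ℚ) * _ = _
    rw [mul_inv_cancel₀ ha]
  rw [sum_congr rfl fun a _ => h a, sum_sub_distrib, ← mul_sum, sum_inv_card_orbitOf]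
  simp [mul_sub, card_univ]

theorem sum_sum_not_sameCycle_inv_add_inv (π : Perm α) :
    ∑ a, ∑ b, (if SameCycle π a b then 0
      else (#(orbitOf π a) : ℚ)⁻¹ + (#(orbitOf π b) : ℚ)⁻¹) =
      2 * (Fintype.card α * (#(orbits π) - 1)) := by
  have h : ∀ a b, (if SameCycle π a b then 0
      else (#(orbitOf π a) : ℚ)⁻¹ + (#(orbitOf π b) : ℚ)⁻¹) =
      (if SameCycle π a b then 0 else (#(orbitOf π a) : ℚ)⁻¹) +
        (if SameCycle π b a then 0 else (#(orbitOf π b) : ℚ)⁻¹) := by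
    intro a b
    simp only [sameCycle_comm (x := b) (y := a)]
    split_ifs <;> simp
  simp only [h, sum_add_distrib]
  rw [sum_comm (f := fun a b => if SameCycle π b a then (0 : ℚ) else (#(orbitOf π b) : ℚ)⁻¹),
    sum_sum_not_sameCycle_inv]
  ring

end Orbits

section Count

variable {α : Type*} [DecidableEq α] [Fintype α]

theorem isSwap_conj_iff {g t : Perm α} : (g * t * g⁻¹).IsSwap ↔ t.IsSwap := by
  rw [isSwap_iff_cycleType, isSwap_iff_cycleType, cycleType_conj]

/-- The number of ways to write `w` as a product of `m` transpositions. -/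
noncomputable def factorizationCount (m : ℕ) (w : Perm α) : ℕ :=
  Nat.card {t : Fin m → Perm α // (∀ i, (t i).IsSwap) ∧ (List.ofFn t).prod = w}

theorem factorizationCount_zero (w : Perm α) :
    factorizationCount 0 w = if w = 1 then 1 else 0 := by
  rw [factorizationCount]
  split_ifs with h
  · subst h
    have : Unique {t : Fin 0 → Perm α // (∀ i, (t i).IsSwap) ∧ (List.ofFn t).prod = 1} :=
      { default := ⟨Fin.elim0, fun i => i.elim0, by simp⟩
        uniq := fun _ => Subtype.ext (Subsingleton.elim _ _) }
    exact Nat.card_unique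
  · have : IsEmpty {t : Fin 0 → Perm α // (∀ i, (t i).IsSwap) ∧ (List.ofFn t).prod = w} :=
      ⟨fun t => h (by simpa using t.2.2.symm)⟩
    exact Nat.card_of_isEmpty

theorem ofFn_snoc_prod {M : Type*} [Monoid M] {m : ℕ} (t : Fin m → M) (s : M) :
    (List.ofFn (Fin.snoc t s : Fin (m + 1) → M)).prod = (List.ofFn t).prod * s := by
  rw [List.ofFn_succ_last]
  simp

open scoped Classical in
theorem factorizationCount_succ (m : ℕ) (w : Perm α) :
    factorizationCount (m + 1) w =
      ∑ s : {s : Perm α // s.IsSwap}, factorizationCount m (w * (s : Perm α)) := by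
  simp only [factorizationCount]
  rw [← Nat.card_sigma]
  have key : ∀ {s : Perm α}, s.IsSwap → s * s = 1 := by
    rintro s ⟨a, b, -, rfl⟩
    exact swap_mul_self a b
  have hsnoc : ∀ (s : Perm α) (t : Fin m → Perm α), s.IsSwap → (∀ i, (t i).IsSwap) →
      ∀ i, (Fin.snoc t s : Fin (m + 1) → Perm α) i |>.IsSwap := fun s t hs ht =>
    Fin.lastCases (by simpa using hs) fun j => by simpa using ht j
  have hprod : ∀ (s : Perm α) (t : Fin m → Perm α), s.IsSwap → (List.ofFn t).prod = w * s →
      (List.ofFn (Fin.snoc t s : Fin (m + 1) → Perm α)).prod = w := fun s t hs ht => by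
    rw [ofFn_snoc_prod, ht, mul_assoc, key hs, mul_one]
  have hinit : ∀ t : Fin (m + 1) → Perm α, (t (Fin.last m)).IsSwap → (List.ofFn t).prod = w →
      (List.ofFn (Fin.init t : Fin m → Perm α)).prod = w * t (Fin.last m) := by
    intro t ht h
    rw [← Fin.snoc_init_self t, ofFn_snoc_prod] at h
    rw [← h, mul_assoc, key ht, mul_one]
  exact (Nat.card_congr
    { toFun := fun x => ⟨Fin.snoc x.2.1 x.1.1, hsnoc _ _ x.1.2 x.2.2.1,
        hprod _ _ x.1.2 x.2.2.2⟩
      invFun := fun t => ⟨⟨t.1 (Fin.last m), t.2.1 _⟩, ⟨Fin.init t.1, fun i => t.2.1 _,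
        hinit t.1 (t.2.1 _) t.2.2⟩⟩
      left_inv := by
        rintro ⟨⟨s, hs⟩, ⟨t, ht, hw⟩⟩
        refine Sigma.subtype_ext ?_ ?_ <;> simp
      right_inv := by
        rintro ⟨t, ht, hw⟩
        simp }).symm

theorem factorizationCount_conj (m : ℕ) (g w : Perm α) :
    factorizationCount m (g * w * g⁻¹) = factorizationCount m w := by
  refine (Nat.card_congr (Equiv.subtypeEquiv
    ((Equiv.refl (Fin m)).arrowCongr (MulAut.conj g).toEquiv) fun t => ?_)).symm
  refine and_congr (forall_congr' fun i => isSwap_conj_iff.symm) ?_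
  have : List.ofFn (((Equiv.refl (Fin m)).arrowCongr (MulAut.conj g).toEquiv) t) =
      (List.ofFn t).map (MulAut.conj g) := by
    rw [List.map_ofFn]; rfl
  rw [this, ← map_list_prod, ← MulAut.conj_apply, EmbeddingLike.apply_eq_iff_eq]

theorem card_filter_swap_eq {s : Perm α} (hs : s.IsSwap) :
    #{p : α × α | p.1 ≠ p.2 ∧ swap p.1 p.2 = s} = 2 := by
  obtain ⟨a, b, hab, rfl⟩ := hs
  have : ({p : α × α | p.1 ≠ p.2 ∧ swap p.1 p.2 = swap a b} : Finset (α × α)) =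
      {(a, b), (b, a)} := by
    ext ⟨x, y⟩
    simp only [mem_filter, mem_univ, true_and, mem_insert, mem_singleton, Prod.mk.injEq]
    constructor
    · rintro ⟨hxy, h⟩
      have h1 := Equiv.congr_fun h x
      rw [swap_apply_left] at h1
      rcases eq_or_ne x a with rfl | hxa
      · rw [swap_apply_left] at h1
        exact .inl ⟨rfl, h1⟩
      · rcases eq_or_ne x b with rfl | hxb
        · rw [swap_apply_right] at h1
          exact .inr ⟨rfl, h1⟩
        · rw [swap_apply_of_ne_of_ne hxa hxb] at h1
          exact absurd h1.symm hxy
    · rintro (⟨rfl, rfl⟩ | ⟨rfl, rfl⟩)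
      · exact ⟨hab, rfl⟩
      · exact ⟨hab.symm, swap_comm _ _⟩
  rw [this, card_pair]
  simp [hab]

open scoped Classical in
/-- Every transposition arises from exactly two ordered pairs of points. -/
theorem sum_swap_eq_two_mul (g : Perm α → ℚ) :
    ∑ a, ∑ b, (if a = b then 0 else g (swap a b)) =
      2 * ∑ s : {s : Perm α // s.IsSwap}, g s := by
  have hmaps : ∀ p ∈ ({p : α × α | p.1 ≠ p.2} : Finset (α × α)),
      swap p.1 p.2 ∈ ({s : Perm α | s.IsSwap} : Finset (Perm α)) := fun p hp =>
    mem_filter.2 ⟨mem_univ _, p.1, p.2, (mem_filter.1 hp).2, rfl⟩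
  have hsub : ∑ s : {s : Perm α // s.IsSwap}, g s =
      ∑ s : Perm α with s.IsSwap, g s := by
    rw [← sum_subtype_eq_sum_filter, subtype_univ]
  rw [← Fintype.sum_prod_type' (f := fun a b => if a = b then 0 else g (swap a b)), hsub, mul_sum]
  simp only [← ite_not (_ = _) (g _)]
  rw [← sum_filter, ← sum_fiberwise_of_maps_to hmaps]
  refine sum_congr rfl fun s hs => ?_
  rw [filter_filter, sum_congr rfl (g := fun _ => g s), sum_const,
    card_filter_swap_eq (mem_filter.1 hs).2]
  · simp
  · intro p hp
    rw [(mem_filter.1 hp).2.2]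

/-- The number of sequences of `m` transpositions taking `π` by left multiplication to a
permutation with a single orbit. -/
noncomputable def mergeCount (m : ℕ) (π : Perm α) : ℕ :=
  ∑ c : Perm α with #(orbits c) = 1, factorizationCount m (c * π⁻¹)

theorem mergeCount_zero (π : Perm α) :
    mergeCount 0 π = if #(orbits π) = 1 then 1 else 0 := by
  simp only [mergeCount, factorizationCount_zero, mul_inv_eq_one]
  rw [sum_ite_eq']
  simp

open scoped Classical in
theorem mergeCount_succ (m : ℕ) (π : Perm α) :
    mergeCount (m + 1) π =
      ∑ s : {s : Perm α // s.IsSwap}, mergeCount m ((s : Perm α) * π) := by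
  simp only [mergeCount, factorizationCount_succ]
  rw [sum_comm]
  refine sum_congr rfl fun s _ => sum_congr rfl fun c _ => ?_
  obtain ⟨_, a, b, -, rfl⟩ := s
  rw [mul_inv_rev, swap_inv, mul_assoc]

theorem mergeCount_eq_zero {m : ℕ} {π : Perm α} (h : m + 1 < #(orbits π)) :
    mergeCount m π = 0 := by
  induction m generalizing π with
  | zero => rw [mergeCount_zero, if_neg (by lia)]
  | succ m ih =>
    rw [mergeCount_succ]
    refine sum_eq_zero fun s _ => ih ?_
    obtain ⟨_, a, b, -, rfl⟩ := s
    have := card_orbits_le_swap_mul_add_one π a b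
    dsimp only
    lia

theorem prod_card_orbits_of_card_eq_one {π : Perm α} (h : #(orbits π) = 1) :
    ∏ B ∈ orbits π, (#B : ℚ) = Fintype.card α := by
  have hsum := sum_inv_card_orbitOf π
  obtain ⟨B, hB⟩ := card_eq_one.1 h
  have hB' : ∀ a, orbitOf π a = B := fun a => by
    simpa [hB] using orbitOf_mem_orbits π a
  simp only [hB', h, sum_const, card_univ, nsmul_eq_mul, Nat.cast_one] at hsum
  rw [hB, prod_singleton]
  exact (eq_of_mul_inv_eq_one hsum).symm

/-- A permutation with `m + 1` orbits can be taken to a single orbit by `m` transpositions in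
`m! * #α ^ (m - 1) * ∏ #B` ways, where `B` runs over its orbits. -/
theorem card_mul_mergeCount {m : ℕ} {π : Perm α} (h : #(orbits π) = m + 1) :
    (Fintype.card α : ℚ) * mergeCount m π =
      m.factorial * (Fintype.card α : ℚ) ^ m * ∏ B ∈ orbits π, (#B : ℚ) := by
  induction m generalizing π with
  | zero => simp [mergeCount_zero, h, prod_card_orbits_of_card_eq_one h]
  | succ m ih =>
    have h2 : 2 * ((Fintype.card α : ℚ) * mergeCount (m + 1) π) =
        2 * ((m + 1).factorial * (Fintype.card α : ℚ) ^ (m + 1) *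
          ∏ B ∈ orbits π, (#B : ℚ)) := by
      classical
      rw [mergeCount_succ, Nat.cast_sum, mul_sum,
        ← sum_swap_eq_two_mul fun s => (Fintype.card α : ℚ) * (mergeCount m (s * π) : ℕ)]
      have key : ∀ a b, (if a = b then 0
          else (Fintype.card α : ℚ) * (mergeCount m (swap a b * π) : ℕ)) =
          (m.factorial * (Fintype.card α : ℚ) ^ m * ∏ B ∈ orbits π, (#B : ℚ)) *
          if SameCycle π a b then 0
            else (#(orbitOf π a) : ℚ)⁻¹ + (#(orbitOf π b) : ℚ)⁻¹ := by
        intro a b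
        by_cases hab : SameCycle π a b
        · have := card_orbits_le_of_sameCycle hab
          rw [mergeCount_eq_zero (by lia)]
          simp [hab]
        · have hne : a ≠ b := fun e => hab (e ▸ SameCycle.refl π a)
          have := card_orbits_swap_mul hab
          rw [if_neg hne, if_neg hab, ih (by lia), prod_card_orbits_swap_mul hab]
          ring
      simp only [key, ← mul_sum]
      rw [sum_sum_not_sameCycle_inv_add_inv, h, Nat.factorial_succ]
      push_cast
      ring
    exact mul_left_cancel₀ two_ne_zero h2

end Count

section LongCycle

variable {α : Type*} [DecidableEq α] [Fintype α]

theorem card_orbits_eq_one_iff (hα : 2 ≤ Fintype.card α) {c : Perm α} :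
    #(orbits c) = 1 ↔ c.IsCycle ∧ c.support = univ := by
  have : Nontrivial α := Fintype.one_lt_card_iff_nontrivial.1 hα
  constructor
  · intro h
    have hs : ∀ x y, SameCycle c x y := fun x y => orbitOf_eq_iff.1 <|
      card_le_one.1 h.le _ (orbitOf_mem_orbits c x) _ (orbitOf_mem_orbits c y)
    have hfix : ∀ x, c x ≠ x := fun x hx => by
      obtain ⟨y, hy⟩ := exists_ne x
      exact hy ((hs x y).eq_of_left hx).symm
    obtain ⟨x⟩ : Nonempty α := inferInstance
    exact ⟨⟨x, hfix x, fun y _ => hs x y⟩, by ext y; simpa using hfix y⟩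
  · rintro ⟨hc, hsupp⟩
    have hfix : ∀ x, c x ≠ x := fun x => by
      rw [← mem_support, hsupp]; exact mem_univ x
    obtain ⟨x⟩ : Nonempty α := inferInstance
    refine card_eq_one.2 ⟨orbitOf c x, ?_⟩
    ext B
    rw [mem_singleton, orbits, mem_image]
    constructor
    · rintro ⟨y, -, rfl⟩
      exact orbitOf_eq_iff.2 (hc.sameCycle (hfix y) (hfix x))
    · rintro rfl
      exact ⟨x, mem_univ x, rfl⟩

theorem isCycle_and_support_eq_univ_iff {c : Perm α} :
    c.IsCycle ∧ c.support = univ ↔ c.cycleType = {Fintype.card α} := by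
  constructor
  · rintro ⟨hc, hsupp⟩
    rw [hc.cycleType, hsupp, card_univ]
  · intro h
    refine ⟨card_cycleType_eq_one.1 (by rw [h, Multiset.card_singleton]), ?_⟩
    rw [← card_eq_iff_eq_univ, ← sum_cycleType, h, Multiset.sum_singleton]

/-- Dénes: a cycle through all points of a set of `m + 1 ≥ 2` elements has `(m + 1) ^ (m - 1)`
minimal factorizations into transpositions. -/
theorem factorizationCount_of_isCycle {m : ℕ} (hm : 1 ≤ m) (hα : Fintype.card α = m + 1)
    {c : Perm α} (hc : c.IsCycle ∧ c.support = univ) :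
    factorizationCount m c = (m + 1) ^ (m - 1) := by
  have hα2 : 2 ≤ Fintype.card α := by lia
  have hmerge := card_mul_mergeCount (m := m) (π := (1 : Perm α)) (by rw [card_orbits_one, hα])
  have hsum : mergeCount m (1 : Perm α) = m.factorial * factorizationCount m c := by
    rw [mergeCount]
    simp only [card_orbits_eq_one_iff hα2, isCycle_and_support_eq_univ_iff, inv_one, mul_one]
    rw [sum_congr rfl (g := fun _ => factorizationCount m c), sum_const,
      card_of_cycleType_singleton hα2 le_rfl, hα, Nat.choose_self, mul_one, Nat.add_sub_cancel,
      smul_eq_mul]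
    intro d hd
    rw [mem_filter, ← isCycle_and_support_eq_univ_iff.1 hc, ← isConj_iff_cycleType_eq,
      isConj_comm, isConj_iff] at hd
    obtain ⟨g, rfl⟩ := hd.2
    exact factorizationCount_conj m g c
  rw [prod_card_orbits_one, hsum, hα, mul_one] at hmerge
  obtain ⟨k, rfl⟩ := Nat.exists_eq_add_of_le' hm
  have hfac : ((k + 1).factorial : ℚ) ≠ 0 := by exact_mod_cast (k + 1).factorial_ne_zero
  have hk : ((k + 1 + 1 : ℕ) : ℚ) ≠ 0 := by positivity
  have : (factorizationCount (k + 1) c : ℚ) = ((k + 1 + 1 : ℕ) : ℚ) ^ k := by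
    refine mul_left_cancel₀ (mul_ne_zero hk hfac) ?_
    rw [pow_succ] at hmerge
    push_cast at hmerge ⊢
    linear_combination hmerge
  exact_mod_cast this

theorem isReflectionOf_isSwap_iff {t : Perm α} :
    IsReflectionOf {σ : Perm α | σ.IsSwap} t ↔ t.IsSwap := by
  constructor
  · rintro ⟨g, s, hs, rfl⟩
    exact isSwap_conj_iff.2 hs
  · exact fun h => ⟨1, t, h, by simp⟩

theorem absLength_le_length {w : Perm α} {l : List (Perm α)} (hl : ∀ t ∈ l, t.IsSwap)
    (hw : l.prod = w) : absLength {σ : Perm α | σ.IsSwap} w ≤ l.length :=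
  Nat.sInf_le ⟨l, fun t ht => isReflectionOf_isSwap_iff.2 (hl t ht), rfl, hw⟩

theorem exists_length_eq_absLength (w : Perm α) :
    ∃ l : List (Perm α), (∀ t ∈ l, t.IsSwap) ∧
      l.length = absLength {σ : Perm α | σ.IsSwap} w ∧ l.prod = w := by
  have hne : {k | ∃ l : List (Perm α), (∀ t ∈ l, IsReflectionOf {σ : Perm α | σ.IsSwap} t) ∧
      l.length = k ∧ l.prod = w}.Nonempty := by
    obtain ⟨l, hl, hl'⟩ := (truncSwapFactors w).out
    exact ⟨l.length, l, fun t ht => isReflectionOf_isSwap_iff.2 (hl' t ht), rfl, hl⟩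
  obtain ⟨l, hl, hlen, hw⟩ := Nat.sInf_mem hne
  exact ⟨l, fun t ht => isReflectionOf_isSwap_iff.1 (hl t ht), hlen, hw⟩

theorem absLength_eq_one_iff {w : Perm α} :
    absLength {σ : Perm α | σ.IsSwap} w = 1 ↔ w.IsSwap := by
  obtain ⟨l, hl, hlen, rfl⟩ := exists_length_eq_absLength w
  constructor
  · intro h
    obtain ⟨t, rfl⟩ := List.length_eq_one_iff.1 (hlen.trans h)
    simpa using hl
  · intro h
    refine le_antisymm (absLength_le_length (l := [l.prod]) (by simpa using h) (by simp)) ?_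
    rw [Nat.one_le_iff_ne_zero, ← hlen]
    intro h0
    rw [List.length_eq_zero_iff.1 h0, List.prod_nil] at h
    exact h.isCycle.ne_one rfl

/-- Along a factorization of a long cycle into `m` transpositions the absolute length of the
partial products increases by one at each step. -/
theorem absLength_partialProd {m : ℕ} (hm : 1 ≤ m) (hα : Fintype.card α = m + 1) {c : Perm α}
    (hc : c.IsCycle ∧ c.support = univ) {t : Fin m → Perm α} (ht : ∀ i, (t i).IsSwap)
    (hprod : (List.ofFn t).prod = c) (i : Fin (m + 1)) :
    absLength {σ : Perm α | σ.IsSwap} (Fin.partialProd t i) = i := by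
  have hmem : ∀ s ∈ List.ofFn t, s.IsSwap := fun s hs => by
    obtain ⟨j, rfl⟩ := List.mem_ofFn.1 hs
    exact ht j
  have hi : (i : ℕ) ≤ m := Nat.lt_succ_iff.1 i.2
  refine le_antisymm ?_ ?_
  · refine (absLength_le_length (fun s hs => hmem s (List.mem_of_mem_take hs)) rfl).trans ?_
    simp
  · obtain ⟨l, hl, hlen, hw⟩ := exists_length_eq_absLength (Fin.partialProd t i)
    have h := card_le_card_orbits_prod_add_length (l ++ (List.ofFn t).drop i) fun s hs =>
      (List.mem_append.1 hs).elim (hl s) fun hs => hmem s (List.mem_of_mem_drop hs)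
    have hone : #(orbits c) = 1 := (card_orbits_eq_one_iff (by lia)).2 hc
    rw [List.prod_append, hw, Fin.partialProd, List.prod_take_mul_prod_drop, hprod, hone, hα,
      List.length_append, List.length_drop, List.length_ofFn, hlen] at h
    lia

theorem maxChainCount_eq_factorizationCount {m : ℕ} (hm : 1 ≤ m) (hα : Fintype.card α = m + 1)
    {c : Perm α} (hc : c.IsCycle ∧ c.support = univ) :
    maxChainCount {σ : Perm α | σ.IsSwap} c m = factorizationCount m c := by
  have hlast : ∀ t : Fin m → Perm α, Fin.partialProd t (Fin.last m) = (List.ofFn t).prod := by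
    intro t
    rw [Fin.partialProd, Fin.val_last, List.take_of_length_le (by simp)]
  have hquot : ∀ y : Fin (m + 1) → Perm α, y 0 = 1 →
      Fin.partialProd (fun i : Fin m => (y i.castSucc)⁻¹ * y i.succ) = y := by
    intro y hy
    have h := Fin.partialProd_left_inv y
    rwa [hy, one_smul] at h
  exact Nat.card_congr
    { toFun := fun y => ⟨fun i => (y.1 i.castSucc)⁻¹ * y.1 i.succ, fun i => by
          have h := y.2.2.2.1 i
          rw [absLe, y.2.2.2.2, y.2.2.2.2, Fin.val_castSucc, Fin.val_succ] at h
          exact absLength_eq_one_iff.1 (Nat.add_left_cancel h), by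
          rw [← hlast, hquot y.1 y.2.1, y.2.2.1]⟩
      invFun := fun t => ⟨Fin.partialProd t.1, Fin.partialProd_zero _, by rw [hlast, t.2.2],
        fun i => by
          rw [absLe, absLength_partialProd hm hα hc t.2.1 t.2.2,
            absLength_partialProd hm hα hc t.2.1 t.2.2, Fin.partialProd_right_inv,
            absLength_eq_one_iff.2 (t.2.1 i), Fin.val_castSucc, Fin.val_succ],
        absLength_partialProd hm hα hc t.2.1 t.2.2⟩
      left_inv := fun y => Subtype.ext (hquot y.1 y.2.1)
      right_inv := fun t => Subtype.ext (funext fun i => Fin.partialProd_right_inv t.1 i) }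

end LongCycle

end MinimalFactorization

/-- **Theorem (maximal chains of noncrossing partitions of type `Aₙ`).**
For `n ≥ 1` and any `(n+1)`-cycle `c` in the symmetric group `S_{n+1}`, the number of
maximal chains in the interval `[1,c]` of the absolute order (with respect to the
transpositions) is `(n+1)^{n-1}`; equivalently, the number of sequences `(t₁,…,tₙ)` of
transpositions with `t₁t₂⋯tₙ = c` is `(n+1)^{n-1}`. -/
theorem typeA_max_chain_count
    (n : ℕ) (hn : 1 ≤ n) (c : Equiv.Perm (Fin (n + 1)))
    (hc : c.IsCycle ∧ c.support = Finset.univ) :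
    maxChainCount {σ : Equiv.Perm (Fin (n + 1)) | σ.IsSwap} c n = (n + 1) ^ (n - 1) ∧
    Nat.card {t : Fin n → Equiv.Perm (Fin (n + 1)) //
        (∀ i, (t i).IsSwap) ∧ (List.ofFn t).prod = c} = (n + 1) ^ (n - 1) := by
  have hcard : Fintype.card (Fin (n + 1)) = n + 1 := Fintype.card_fin _
  have h := MinimalFactorization.factorizationCount_of_isCycle hn hcard hc
  exact ⟨(MinimalFactorization.maxChainCount_eq_factorizationCount hn hcard hc).trans h, h⟩
end

section
/- Let n ≥ 2 and let (W,S) be a Coxeter system of type Bₙ, i.e., with simple reflections s₁,…,sₙ where the order of s_i s_{i+1} is 3 for 1 ≤ i ≤ n−2, the order of s_{n−1} sₙ is 4, the order of s_i s_j is 2 for |i−j| ≥ 2, and W is finite. Then the number of maximal chains in the noncrossing partition lattice L_W equals nⁿ. -/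
open scoped BigOperators

section LinearAlgebra

open Polynomial

variable {ι : Type*} [Fintype ι] [DecidableEq ι]

lemma det_add_vecMulVec_of_ne_zero {R : Type*} [CommRing R] [IsDomain R] (A : Matrix ι ι R)
    (hA : A.det ≠ 0) (u v : ι → R) :
    (A + Matrix.vecMulVec u v).det = A.det + v ⬝ᵥ (A.adjugate.mulVec u) := by
  classical
  cases isEmpty_or_nonempty ι
  · simp
  have h1 : A.adjugate * (A + Matrix.vecMulVec u v)
      = Matrix.scalar ι A.det - Matrix.vecMulVec (-(A.adjugate.mulVec u)) v := by
    rw [mul_add, Matrix.adjugate_mul, Matrix.mul_vecMulVec, Matrix.neg_vecMulVec, sub_neg_eq_add]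
    congr 1
    ext i j
    simp [Matrix.scalar_apply, Matrix.diagonal, Matrix.one_apply]
  have h2 := congrArg Matrix.det h1
  rw [Matrix.det_mul, Matrix.det_adjugate, ← Matrix.eval_charpoly, Matrix.charpoly_vecMulVec] at h2
  obtain ⟨m, hm⟩ : ∃ m, Fintype.card ι = m + 1 :=
    ⟨Fintype.card ι - 1, (Nat.succ_pred_eq_of_pos Fintype.card_pos).symm⟩
  have h3 : A.det ^ m ≠ 0 := pow_ne_zero _ hA
  apply mul_left_cancel₀ h3
  simp [hm, pow_succ] at h2
  rw [h2, dotProduct_comm v]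
  ring

lemma derivative_charpoly_eq_trace_adjugate {R : Type*} [CommRing R] (M : Matrix ι ι R) :
    derivative M.charpoly = (M.charmatrix.adjugate).trace := by
  have key : ∀ i : ι, M.charmatrix.adjugate i i =
      (M.charmatrix.updateCol i (Pi.single i 1)).det := by
    intro i
    rw [← Matrix.cramer_apply, Matrix.cramer_eq_adjugate_mulVec]
    simp
  rw [Matrix.trace, Matrix.charpoly, Matrix.det_apply]
  simp only [Matrix.diag, key, Matrix.det_apply]
  rw [Finset.sum_comm, derivative_sum]
  refine Finset.sum_congr rfl fun σ _ => ?_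
  rw [← Finset.smul_sum, Units.smul_def, Units.smul_def, derivative_smul]
  congr 1
  rw [derivative_prod_finset]
  refine Finset.sum_congr rfl fun i _ => ?_
  rw [← Finset.mul_prod_erase Finset.univ _ (Finset.mem_univ i), mul_comm]
  congr 1
  · by_cases h : σ i = i
    · simp [h]
    · simp [h]
  · refine Finset.prod_congr rfl fun j hj => ?_
    rw [Matrix.updateCol_ne (Finset.ne_of_mem_erase hj)]

end LinearAlgebra

section PermutationCharpoly

open Polynomial

variable {n : ℕ}

/-- The characteristic polynomial of the action of a permutation of `Fin n` on the quotient of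
`ℚⁿ` by the constant vectors. -/
noncomputable def reducedCharpoly (σ : Equiv.Perm (Fin n)) : ℚ[X] :=
  (σ.permMatrix ℚ).charpoly /ₘ (X - C 1)

lemma permMatrix_mulVec_one (σ : Equiv.Perm (Fin n)) :
    (σ.permMatrix ℚ).mulVec 1 = 1 := by
  rw [Matrix.permMatrix_mulVec]; rfl

lemma X_sub_one_mul_reducedCharpoly (hn : n ≠ 0) (σ : Equiv.Perm (Fin n)) :
    (X - 1) * reducedCharpoly σ = (σ.permMatrix ℚ).charpoly := by
  have : NeZero n := ⟨hn⟩
  have h : (σ.permMatrix ℚ).charpoly.IsRoot 1 := by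
    rw [IsRoot, Matrix.eval_charpoly, ← Matrix.exists_mulVec_eq_zero_iff]
    refine ⟨1, one_ne_zero, ?_⟩
    rw [Matrix.sub_mulVec, permMatrix_mulVec_one]
    simp
  have := mul_divByMonic_eq_iff_isRoot.2 h
  rwa [C_1] at this

lemma map_permMatrix_mulVec_one (σ : Equiv.Perm (Fin n)) :
    ((σ.permMatrix ℚ).map (C : ℚ → ℚ[X])).mulVec 1 = 1 := by
  ext1 i
  simp [Matrix.mulVec, dotProduct]

lemma charmatrix_mulVec_one (σ : Equiv.Perm (Fin n)) :
    (σ.permMatrix ℚ).charmatrix.mulVec 1 = (X - 1 : ℚ[X]) • 1 := by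
  rw [Matrix.charmatrix, Matrix.sub_mulVec]
  simp only [RingHom.mapMatrix_apply]
  rw [map_permMatrix_mulVec_one]
  ext1 i
  simp [Matrix.scalar_apply]

lemma sum_adjugate_charmatrix (hn : n ≠ 0) (σ : Equiv.Perm (Fin n)) :
    (1 : Fin n → ℚ[X]) ⬝ᵥ (σ.permMatrix ℚ).charmatrix.adjugate.mulVec 1
      = n * reducedCharpoly σ := by
  have hX : (X - 1 : ℚ[X]) ≠ 0 := by
    simpa only [C_1] using X_sub_C_ne_zero (1 : ℚ)
  apply mul_left_cancel₀ hX
  have h : (σ.permMatrix ℚ).charmatrix.adjugate.mulVec ((X - 1 : ℚ[X]) • 1) =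
      (σ.permMatrix ℚ).charpoly • 1 := by
    rw [← charmatrix_mulVec_one σ, Matrix.mulVec_mulVec, Matrix.adjugate_mul, Matrix.smul_mulVec,
      Matrix.one_mulVec, Matrix.charpoly]
  rw [mul_left_comm, X_sub_one_mul_reducedCharpoly hn, ← smul_eq_mul (a := X - 1),
    ← dotProduct_smul, ← Matrix.mulVec_smul, h]
  simp [dotProduct, mul_comm]

/-- The difference of two standard basis vectors. -/
def rootVector (R : Type*) [Ring R] (p : Fin n × Fin n) : Fin n → R :=
  Pi.single p.1 1 - Pi.single p.2 1

lemma permMatrix_swap_mul (σ : Equiv.Perm (Fin n)) (p : Fin n × Fin n) :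
    (Equiv.swap p.1 p.2 * σ).permMatrix ℚ = σ.permMatrix ℚ
      - Matrix.vecMulVec ((σ.permMatrix ℚ).mulVec (rootVector ℚ p)) (rootVector ℚ p) := by
  obtain ⟨a, b⟩ := p
  ext i j
  simp only [Matrix.permMatrix_mulVec, Matrix.sub_apply, Matrix.vecMulVec_apply, Function.comp,
    rootVector, Equiv.Perm.permMatrix, Equiv.toPEquiv_apply, PEquiv.toMatrix_apply,
    Equiv.Perm.mul_apply, Pi.sub_apply, Pi.single_apply, Option.mem_def, Option.some.injEq]
  rw [Equiv.swap_apply_def]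
  grind

lemma charpoly_swap_mul (σ : Equiv.Perm (Fin n)) (p : Fin n × Fin n) :
    ((Equiv.swap p.1 p.2 * σ).permMatrix ℚ).charpoly = (σ.permMatrix ℚ).charpoly +
      rootVector ℚ[X] p ⬝ᵥ ((σ.permMatrix ℚ).charmatrix.adjugate *
        (σ.permMatrix ℚ).map C).mulVec (rootVector ℚ[X] p) := by
  have h1 : (fun i => C (rootVector ℚ p i)) = rootVector ℚ[X] p := by
    ext1 i
    simp [rootVector, Pi.single_apply, apply_ite (C : ℚ → ℚ[X])]
  rw [← Matrix.mulVec_mulVec, Matrix.charpoly, Matrix.charpoly, ← det_add_vecMulVec_of_ne_zero,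
    permMatrix_swap_mul]
  · congr 1
    rw [← h1]
    ext1 i j
    simp [Matrix.charmatrix, Matrix.vecMulVec_apply, Matrix.mulVec, dotProduct]
    ring
  · exact (Matrix.charpoly_monic _).ne_zero

lemma sum_rootVector_quadratic {R : Type*} [CommRing R] (B : Matrix (Fin n) (Fin n) R) :
    ∑ p : Fin n × Fin n, rootVector R p ⬝ᵥ B.mulVec (rootVector R p)
      = 2 * n * B.trace - 2 * ((1 : Fin n → R) ⬝ᵥ B.mulVec 1) := by
  have h : ∀ p : Fin n × Fin n, rootVector R p ⬝ᵥ B.mulVec (rootVector R p) =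
      B p.1 p.1 + B p.2 p.2 - B p.1 p.2 - B p.2 p.1 := by
    intro p
    simp [rootVector, Matrix.mulVec_sub, sub_dotProduct, dotProduct_sub]
    ring
  have h2 : ∑ x, ∑ y, B y x = ∑ x, ∑ y, B x y := Finset.sum_comm
  simp only [h, Fintype.sum_prod_type, Finset.sum_add_distrib, Finset.sum_sub_distrib, h2]
  simp [Matrix.trace, dotProduct, Matrix.mulVec, ← Finset.mul_sum]
  ring

lemma sum_reducedCharpoly_swap_mul (hn : n ≠ 0) (σ : Equiv.Perm (Fin n)) :
    ∑ p : Fin n × Fin n, reducedCharpoly (Equiv.swap p.1 p.2 * σ) =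
      ((n : ℚ[X]) ^ 2 - 2 * (n : ℚ[X]) * ((n : ℚ[X]) - 1)) * reducedCharpoly σ
        + 2 * (n : ℚ[X]) * (X * derivative (reducedCharpoly σ)) := by
  have hX : (X - 1 : ℚ[X]) ≠ 0 := by
    simpa only [C_1] using X_sub_C_ne_zero (1 : ℚ)
  apply mul_left_cancel₀ hX
  have hq := X_sub_one_mul_reducedCharpoly hn σ
  have hq' : derivative (σ.permMatrix ℚ).charpoly =
      reducedCharpoly σ + (X - 1) * derivative (reducedCharpoly σ) := by
    rw [← hq, derivative_mul]; simp
  have hadj : (σ.permMatrix ℚ).charmatrix.adjugate * (σ.permMatrix ℚ).map C =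
      (X : ℚ[X]) • (σ.permMatrix ℚ).charmatrix.adjugate - (σ.permMatrix ℚ).charpoly • 1 := by
    have : (σ.permMatrix ℚ).map (C : ℚ → ℚ[X]) =
        Matrix.scalar (Fin n) X - (σ.permMatrix ℚ).charmatrix := by
      simp [Matrix.charmatrix]
    rw [this, mul_sub, Matrix.adjugate_mul, Matrix.charpoly]
    congr 1
    rw [Matrix.scalar_apply, ← Matrix.smul_one_eq_diagonal]
    simp
  have h1 : (1 : Fin n → ℚ[X]) ⬝ᵥ ((σ.permMatrix ℚ).charmatrix.adjugate *
        (σ.permMatrix ℚ).map C).mulVec 1 = n * reducedCharpoly σ := by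
    rw [← Matrix.mulVec_mulVec, map_permMatrix_mulVec_one, sum_adjugate_charmatrix hn]
  rw [Finset.mul_sum]
  simp only [X_sub_one_mul_reducedCharpoly hn, charpoly_swap_mul]
  rw [Finset.sum_add_distrib, sum_rootVector_quadratic, h1, hadj, Matrix.trace_sub,
    Matrix.trace_smul, Matrix.trace_smul, ← derivative_charpoly_eq_trace_adjugate, hq', ← hq]
  simp
  ring

lemma eval_one_reducedCharpoly_eq_zero (hn : n ≠ 0) (σ : Equiv.Perm (Fin n)) (s : Set (Fin n))
    (hs : ∀ i, σ i ∈ s ↔ i ∈ s) (hne : s.Nonempty) (hne' : sᶜ.Nonempty) :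
    (reducedCharpoly σ).eval 1 = 0 := by
  classical
  have h := det_add_vecMulVec_of_ne_zero (σ.permMatrix ℚ).charmatrix
    (Matrix.charpoly_monic _).ne_zero 1 1
  rw [sum_adjugate_charmatrix hn] at h
  have h2 := congrArg (eval (1 : ℚ)) h
  rw [eval_add, eval_mul, ← Matrix.charpoly, ← X_sub_one_mul_reducedCharpoly hn] at h2
  have h3 : eval (1 : ℚ) ((σ.permMatrix ℚ).charmatrix + Matrix.vecMulVec 1 1).det = 0 := by
    rw [← coe_evalRingHom, RingHom.map_det, ← Matrix.exists_mulVec_eq_zero_iff]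
    set a : ℚ := ∑ i, if i ∈ s then 1 else 0 with ha
    have ha0 : a ≠ 0 := by
      obtain ⟨i, hi⟩ := hne
      have : 0 < a := Finset.sum_pos' (fun j _ => by split_ifs <;> norm_num)
        ⟨i, Finset.mem_univ _, by simp [hi]⟩
      exact this.ne'
    refine ⟨fun i => (n : ℚ) * (if i ∈ s then 1 else 0) - a, ?_, ?_⟩
    · obtain ⟨i, hi⟩ := hne'
      intro h0
      have := congrFun h0 i
      simp [show i ∉ s from hi] at this
      exact ha0 this
    · have hmat : (evalRingHom (1 : ℚ)).mapMatrix
          ((σ.permMatrix ℚ).charmatrix + Matrix.vecMulVec 1 1) =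
          1 - σ.permMatrix ℚ + Matrix.vecMulVec 1 1 := by
        ext i j
        by_cases hij : i = j
        · subst hij; simp [apply_ite (eval (1 : ℚ))]
        · simp [hij, apply_ite (eval (1 : ℚ))]
      rw [hmat, Matrix.add_mulVec, Matrix.sub_mulVec, Matrix.one_mulVec, Matrix.permMatrix_mulVec,
        Matrix.vecMulVec_mulVec]
      ext i
      simp [hs, dotProduct, Finset.sum_sub_distrib, ha, Finset.sum_ite, mul_comm]
  rw [h3] at h2
  simpa [hn] using h2.symm

lemma charpoly_permMatrix_of_isCycle (hn : n ≠ 0) (σ : Equiv.Perm (Fin n)) (hc : σ.IsCycle)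
    (hsupp : σ.support = Finset.univ) : (σ.permMatrix ℚ).charpoly = X ^ n - 1 := by
  have hord : orderOf σ = n := by rw [hc.orderOf, hsupp]; simp
  have : NeZero n := ⟨hn⟩
  set P := σ.permMatrix ℚ with hP
  have hpow : ∀ k, P ^ k = (σ ^ k).permMatrix ℚ := by
    intro k
    induction k with
    | zero => simp [hP]
    | succ k ih => rw [pow_succ, pow_succ', ih, hP, Matrix.permMatrix_mul]
  have hinj : ∀ i < n, ∀ j < n, (σ ^ i) 0 = (σ ^ j) 0 → i = j := by
    intro i hi j hj hij
    have h0 : σ 0 ≠ 0 := by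
      have : (0 : Fin n) ∈ σ.support := by simp [hsupp]
      simpa using this
    have : σ ^ i = σ ^ j := hc.pow_eq_pow_iff.2 ⟨0, h0, hij⟩
    exact pow_injOn_Iio_orderOf (by simpa [hord] using hi) (by simpa [hord] using hj) this
  have hint : IsIntegral ℚ P := Matrix.isIntegral P
  have hdeg : n ≤ (minpoly ℚ P).natDegree := by
    by_contra! hlt
    have h0 := minpoly.aeval ℚ P
    rw [aeval_eq_sum_range' hlt] at h0
    have hlead : (minpoly ℚ P).coeff (minpoly ℚ P).natDegree = 1 := minpoly.monic hint
    have := congrFun (congrFun h0 0) ((σ ^ (minpoly ℚ P).natDegree) 0)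
    rw [Matrix.sum_apply, Finset.sum_eq_single (minpoly ℚ P).natDegree] at this
    · simp [hpow, hlead, Equiv.toPEquiv_apply, PEquiv.toMatrix_apply] at this
    · intro k hk hk'
      have : (σ ^ k) 0 ≠ (σ ^ (minpoly ℚ P).natDegree) 0 := fun h =>
        hk' (hinj _ (Finset.mem_range.1 hk) _ hlt h)
      simp [hpow, Equiv.toPEquiv_apply, PEquiv.toMatrix_apply, this]
    · intro h; exact absurd (Finset.mem_range.2 hlt) h
  have hmonic : (X ^ n - 1 : ℚ[X]).Monic := by
    simpa using monic_X_pow_sub_C (1 : ℚ) hn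
  have hnat : (X ^ n - 1 : ℚ[X]).natDegree = n := by
    simpa using natDegree_X_pow_sub_C (n := n) (r := (1 : ℚ))
  have e1 : minpoly ℚ P = X ^ n - 1 := by
    refine (eq_of_monic_of_dvd_of_natDegree_le (minpoly.monic hint) hmonic
      (minpoly.dvd _ _ ?_) ?_).symm
    · have : σ ^ n = 1 := orderOf_dvd_iff_pow_eq_one.1 hord.dvd
      simp [hpow, this]
    · rw [hnat]; exact hdeg
  have e2 : minpoly ℚ P = P.charpoly := by
    refine (eq_of_monic_of_dvd_of_natDegree_le (minpoly.monic hint) (Matrix.charpoly_monic _)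
      (Matrix.minpoly_dvd_charpoly P) ?_).symm
    rw [Matrix.charpoly_natDegree_eq_dim]
    simpa using hdeg
  rw [← e2, e1]

lemma eval_one_reducedCharpoly_of_isCycle (hn : n ≠ 0) (σ : Equiv.Perm (Fin n)) (hc : σ.IsCycle)
    (hsupp : σ.support = Finset.univ) : (reducedCharpoly σ).eval 1 = n := by
  have h := X_sub_one_mul_reducedCharpoly hn σ
  rw [charpoly_permMatrix_of_isCycle hn σ hc hsupp] at h
  have h2 := congrArg (fun p => (derivative p).eval 1) h
  simpa [derivative_mul, derivative_X_pow] using h2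

lemma reducedCharpoly_one (hn : n ≠ 0) :
    reducedCharpoly (1 : Equiv.Perm (Fin n)) = (X - 1) ^ (n - 1) := by
  have hX : (X - 1 : ℚ[X]) ≠ 0 := by
    simpa only [C_1] using X_sub_C_ne_zero (1 : ℚ)
  apply mul_left_cancel₀ hX
  rw [X_sub_one_mul_reducedCharpoly hn, Matrix.permMatrix_one, Matrix.charpoly_one, ← pow_succ',
    Nat.sub_add_cancel (Nat.one_le_iff_ne_zero.2 hn)]
  simp

end PermutationCharpoly

section WeightedCount

open Polynomial

variable {n : ℕ}

/-- The weight `e` for pairs on the diagonal, and `1` otherwise. -/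
def diagWeight (e : ℚ) (p : Fin n × Fin n) : ℚ := if p.1 = p.2 then e else 1

/-- The weighted sum, over `k`-tuples of pairs of indices, of the reduced characteristic polynomial
of the product of the corresponding transpositions. -/
noncomputable def weightedCharpolySum (n k : ℕ) (e : ℚ) : ℚ[X] :=
  ∑ t : Fin k → Fin n × Fin n, (∏ i, diagWeight e (t i)) •
    reducedCharpoly (List.ofFn fun i => Equiv.swap (t i).1 (t i).2).prod

lemma sum_diagWeight_smul_reducedCharpoly (hn : n ≠ 0) (e : ℚ) (σ : Equiv.Perm (Fin n)) :
    ∑ p : Fin n × Fin n, diagWeight e p • reducedCharpoly (Equiv.swap p.1 p.2 * σ) =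
      ((n : ℚ) ^ 2 - 2 * n * (n - 1) + (e - 1) * n) • reducedCharpoly σ
        + (2 * n : ℚ) • (X * derivative (reducedCharpoly σ)) := by
  have h1 : ∀ p : Fin n × Fin n, diagWeight e p • reducedCharpoly (Equiv.swap p.1 p.2 * σ) =
      reducedCharpoly (Equiv.swap p.1 p.2 * σ) +
        if p.1 = p.2 then (e - 1) • reducedCharpoly σ else 0 := by
    rintro ⟨a, b⟩
    by_cases h : a = b
    · subst h
      rw [diagWeight, if_pos rfl, if_pos rfl, Equiv.swap_self, sub_smul, one_smul]
      change e • reducedCharpoly (1 * σ) = reducedCharpoly (1 * σ) + _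
      rw [one_mul]; abel
    · simp [diagWeight, h]
  simp only [h1, Finset.sum_add_distrib, sum_reducedCharpoly_swap_mul hn]
  rw [Fintype.sum_prod_type]
  have hC : (C 2 : ℚ[X]) = 2 := rfl
  simp [smul_eq_C_mul, hC]
  ring

lemma coeff_weightedCharpolySum (hn : n ≠ 0) (k : ℕ) (e : ℚ) (i : ℕ) :
    (weightedCharpolySum n k e).coeff i =
      ((n : ℚ) ^ 2 - 2 * n * (n - 1) + (e - 1) * n + 2 * n * i) ^ k *
        ((X - 1 : ℚ[X]) ^ (n - 1)).coeff i := by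
  induction k with
  | zero => simp [weightedCharpolySum, reducedCharpoly_one hn]
  | succ k ih =>
    have h : weightedCharpolySum n (k + 1) e =
        ((n : ℚ) ^ 2 - 2 * n * (n - 1) + (e - 1) * n) • weightedCharpolySum n k e +
          (2 * n : ℚ) • (X * derivative (weightedCharpolySum n k e)) := by
      rw [weightedCharpolySum, ← (Fin.consEquiv fun _ => Fin n × Fin n).sum_comp,
        Fintype.sum_prod_type_right]
      simp only [Fin.consEquiv_apply, Fin.prod_univ_succ, Fin.cons_zero, Fin.cons_succ,
        List.ofFn_succ, List.prod_cons]
      simp only [mul_comm (diagWeight e _), mul_smul, ← Finset.smul_sum,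
        sum_diagWeight_smul_reducedCharpoly hn]
      simp only [weightedCharpolySum, derivative_sum, derivative_smul, Finset.mul_sum,
        Finset.smul_sum, ← Finset.sum_add_distrib]
      refine Finset.sum_congr rfl fun t _ => ?_
      simp [smul_eq_C_mul]
      ring
    rw [h]
    have hd : (X * derivative (weightedCharpolySum n k e)).coeff i =
        i * (weightedCharpolySum n k e).coeff i := by
      cases i with
      | zero => simp
      | succ i => simp [coeff_X_mul, coeff_derivative, mul_comm]
    rw [coeff_add, coeff_smul, coeff_smul, hd, ih]
    simp
    ring

lemma natDegree_weightedCharpolySum_lt (hn : n ≠ 0) (k : ℕ) (e : ℚ) :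
    (weightedCharpolySum n k e).natDegree < n := by
  refine lt_of_le_of_lt (b := n - 1) (natDegree_le_iff_coeff_eq_zero.2 fun i hi => ?_) (by omega)
  rw [coeff_weightedCharpolySum hn, coeff_eq_zero_of_natDegree_lt (p := (X - 1) ^ (n - 1)),
    mul_zero]
  have : ((X - 1 : ℚ[X]) ^ (n - 1)).natDegree = n - 1 := by
    have h := natDegree_pow (X - C (1 : ℚ)) (n - 1)
    rwa [natDegree_X_sub_C, mul_one, C_1] at h
  omega

lemma eval_weightedCharpolySum (hn : n ≠ 0) (k : ℕ) (e : ℚ) :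
    (weightedCharpolySum n k e).eval 1 =
      (fwdDiff 1)^[n - 1] (fun x : ℚ =>
        ((n : ℚ) ^ 2 - 2 * n * (n - 1) + (e - 1) * n + 2 * n * x) ^ k) 0 := by
  rw [eval_eq_sum_range' (natDegree_weightedCharpolySum_lt hn k e), fwdDiff_iter_eq_sum_shift,
    Nat.sub_add_cancel (Nat.one_le_iff_ne_zero.2 hn)]
  refine Finset.sum_congr rfl fun i _ => ?_
  have h : ((X - 1 : ℚ[X]) ^ (n - 1)).coeff i = (-1) ^ (n - 1 - i) * (n - 1).choose i := by
    have := coeff_X_add_C_pow (-1 : ℚ) (n - 1) i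
    rwa [C_neg, C_1, ← sub_eq_add_neg] at this
  rw [coeff_weightedCharpolySum hn, h]
  simp
  ring

lemma eval_weightedCharpolySum_sub (hn : n ≠ 0) (k : ℕ) :
    (weightedCharpolySum n k 1).eval 1 - (weightedCharpolySum n k (-1)).eval 1 =
      (2 * n : ℚ) ^ k * (fwdDiff 1)^[n] (fun x : ℚ => x ^ k) (-(n : ℚ) / 2) := by
  have hn' : (n : ℚ) ≠ 0 := by exact_mod_cast hn
  have h1 : (fun x : ℚ => ((n : ℚ) ^ 2 - 2 * n * (n - 1) + ((1 : ℚ) - 1) * n + 2 * n * x) ^ k) =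
      fun x : ℚ => (fun y : ℚ => (2 * n * y - (n : ℚ) ^ 2) ^ k) (x + 1) := by
    ext x; ring
  have h2 : (fun x : ℚ => ((n : ℚ) ^ 2 - 2 * n * (n - 1) + ((-1 : ℚ) - 1) * n + 2 * n * x) ^ k) =
      fun y : ℚ => (2 * n * y - (n : ℚ) ^ 2) ^ k := by
    ext x; ring
  rw [eval_weightedCharpolySum hn, eval_weightedCharpolySum hn, h1, h2,
    fwdDiff_iter_comp_add 1 (fun y : ℚ => (2 * n * y - (n : ℚ) ^ 2) ^ k)]
  have h3 : ∀ f : ℚ → ℚ, (fwdDiff 1)^[n - 1] f (0 + 1) - (fwdDiff 1)^[n - 1] f 0 = (fwdDiff 1)^[n] f 0 := by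
    intro f
    obtain ⟨m, rfl⟩ := Nat.exists_eq_succ_of_ne_zero hn
    rw [Nat.succ_sub_one, Function.iterate_succ_apply', fwdDiff]
  rw [h3]
  have h4 : (fun y : ℚ => (2 * n * y - (n : ℚ) ^ 2) ^ k) =
      (2 * n : ℚ) ^ k • fun y : ℚ => (fun x : ℚ => x ^ k) (y + (-(n : ℚ) / 2)) := by
    ext y
    simp only [Pi.smul_apply, smul_eq_mul, ← mul_pow]
    congr 1
    ring
  rw [h4, fwdDiff_iter_const_smul, Pi.smul_apply, fwdDiff_iter_comp_add 1 (fun x : ℚ => x ^ k), zero_add, smul_eq_mul]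

lemma eval_weightedCharpolySum_sub_of_lt {k : ℕ} (hk : k < n) :
    (weightedCharpolySum n k 1).eval 1 - (weightedCharpolySum n k (-1)).eval 1 = 0 := by
  rw [eval_weightedCharpolySum_sub (by omega), fwdDiff_iter_pow_eq_zero_of_lt hk]
  simp

lemma eval_weightedCharpolySum_sub_self (hn : n ≠ 0) :
    (weightedCharpolySum n n 1).eval 1 - (weightedCharpolySum n n (-1)).eval 1 =
      (2 * n : ℚ) ^ n * n.factorial := by
  rw [eval_weightedCharpolySum_sub hn, fwdDiff_iter_eq_factorial]
  simp

end WeightedCount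

section SignedPermutations

open Polynomial

variable {n : ℕ}

/-- The hyperoctahedral group of signed permutations of `n` letters. -/
abbrev SignedPerm (n : ℕ) : Type := (Fin n → ℤˣ) ⋊[mulAutArrow] Equiv.Perm (Fin n)

lemma mulAutArrow_perm_apply (σ : Equiv.Perm (Fin n)) (d : Fin n → ℤˣ) (i : Fin n) :
    (mulAutArrow σ : MulAut (Fin n → ℤˣ)) d i = d (σ⁻¹ i) := rfl

/-- The sign vector with a single `-1`, at position `i`. -/
def signFlip (i : Fin n) : Fin n → ℤˣ := Pi.mulSingle i (-1)

lemma mulAutArrow_signFlip (σ : Equiv.Perm (Fin n)) (i : Fin n) :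
    (mulAutArrow σ : MulAut (Fin n → ℤˣ)) (signFlip i) = signFlip (σ i) := by
  ext1 j
  rw [mulAutArrow_perm_apply, signFlip, signFlip, Pi.mulSingle_apply, Pi.mulSingle_apply]
  simp only [Equiv.Perm.inv_eq_iff_eq]

lemma signFlip_mul_self (i : Fin n) : signFlip i * signFlip i = 1 := by
  ext1 j
  rw [Pi.mul_apply, Int.units_mul_self, Pi.one_apply]

lemma signFlip_injective : Function.Injective (signFlip : Fin n → Fin n → ℤˣ) := by
  intro i j h
  by_contra hij
  have := congrFun h i
  simp [signFlip, hij] at this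

/-- The reflections of the hyperoctahedral group, indexed by pairs: diagonal pairs give sign
changes, the pairs `i < j` give transpositions and the pairs `i > j` give signed transpositions. -/
def signedReflection (p : Fin n × Fin n) : SignedPerm n :=
  ⟨if p.1 < p.2 then 1 else if p.1 = p.2 then signFlip p.1 else signFlip p.1 * signFlip p.2,
    Equiv.swap p.1 p.2⟩

lemma signedReflection_injective :
    Function.Injective (signedReflection : Fin n × Fin n → SignedPerm n) := by
  rintro ⟨a, b⟩ ⟨c, d⟩ h
  have hr : Equiv.swap a b = Equiv.swap c d := congrArg SemidirectProduct.right h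
  have hl := congrArg SemidirectProduct.left h
  simp only [signedReflection] at hl
  have hne : ∀ x y : Fin n, x ≠ y → signFlip x * signFlip y ≠ 1 := by
    intro x y hxy h1
    exact hxy (signFlip_injective (mul_right_cancel (h1.trans (signFlip_mul_self y).symm)))
  by_cases hab : a = b
  · subst hab
    have hcd : c = d := by
      rw [Equiv.swap_self] at hr
      exact Equiv.swap_eq_refl_iff.1 hr.symm
    subst hcd
    simp only [lt_irrefl, if_false, if_true] at hl
    rw [signFlip_injective hl]
  · have hcd : c ≠ d := by
      rintro rfl
      rw [Equiv.swap_self] at hr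
      exact hab (Equiv.swap_eq_refl_iff.1 hr)
    have h1 : (c = a ∧ d = b) ∨ (c = b ∧ d = a) := by
      have e1 := congrArg (fun σ : Equiv.Perm (Fin n) => σ a) hr
      have e2 := congrArg (fun σ : Equiv.Perm (Fin n) => σ b) hr
      simp only [Equiv.swap_apply_left, Equiv.swap_apply_right, Equiv.swap_apply_def] at e1 e2
      grind
    rcases h1 with ⟨rfl, rfl⟩ | ⟨rfl, rfl⟩
    · rfl
    · exfalso
      rcases lt_or_gt_of_ne hab with hlt | hlt
      · simp [hlt, hlt.not_gt, hcd] at hl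
        exact hne _ _ hcd hl.symm
      · simp [hlt, hlt.not_gt, hab] at hl
        exact hne _ _ hab hl

/-- The product of all signs of a signed permutation. -/
def signProduct : SignedPerm n →* ℤˣ where
  toFun g := ∏ i, g.left i
  map_one' := by simp
  map_mul' g h := by
    simp only [SemidirectProduct.mul_left, Pi.mul_apply, Finset.prod_mul_distrib,
      mulAutArrow_perm_apply]
    rw [Equiv.prod_comp (g.right⁻¹) h.left]

lemma prod_signFlip (i : Fin n) : ∏ j, signFlip i j = -1 := by
  simp [signFlip, Finset.prod_pi_mulSingle']

lemma signProduct_signedReflection (p : Fin n × Fin n) :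
    ((signProduct (signedReflection p) : ℤ) : ℚ) = diagWeight (-1) p := by
  obtain ⟨a, b⟩ := p
  rcases lt_trichotomy a b with h | h | h
  · simp [signProduct, signedReflection, h, diagWeight, h.ne]
  · subst h
    simp [signProduct, signedReflection, diagWeight, prod_signFlip]
  · simp [signProduct, signedReflection, diagWeight, h.ne', h.not_gt, Finset.prod_mul_distrib,
      prod_signFlip]

/-- A signed permutation whose underlying permutation is an `n`-cycle and whose signs multiply
to `-1`. -/
def IsNegativeCycle (g : SignedPerm n) : Prop :=
  g.right.cycleType = {n} ∧ signProduct g = -1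

lemma isCycle_and_support_of_cycleType {σ : Equiv.Perm (Fin n)} (h : σ.cycleType = {n}) :
    σ.IsCycle ∧ σ.support = Finset.univ := by
  constructor
  · rw [← Equiv.Perm.card_cycleType_eq_one, h, Multiset.card_singleton]
  · rw [← Finset.card_eq_iff_eq_univ, ← Equiv.Perm.sum_cycleType, h]
    simp

lemma cycleType_of_forall_invariant (hn : 2 ≤ n) (σ : Equiv.Perm (Fin n))
    (h : ∀ s : Set (Fin n), (∀ i, σ i ∈ s ↔ i ∈ s) → s.Nonempty → s = Set.univ) :
    σ.cycleType = {n} := by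
  have h0 : 0 < n := by omega
  have hs := h {i | σ.SameCycle ⟨0, h0⟩ i} (fun i => Equiv.Perm.sameCycle_apply_right)
    ⟨⟨0, h0⟩, Equiv.Perm.SameCycle.refl _ _⟩
  have hall : ∀ i, σ.SameCycle ⟨0, h0⟩ i := fun i => by
    have : i ∈ {i | σ.SameCycle ⟨0, h0⟩ i} := hs ▸ Set.mem_univ i
    exact this
  have hmove : σ ⟨0, h0⟩ ≠ ⟨0, h0⟩ := by
    intro hfix
    have := (hall ⟨1, by omega⟩).eq_of_left hfix
    simp at this
  have hc : σ.IsCycle := ⟨_, hmove, fun y _ => hall y⟩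
  have hsupp : σ.support = Finset.univ := by
    rw [Finset.eq_univ_iff_forall]
    intro i
    rw [Equiv.Perm.mem_support]
    exact fun hi => hmove ((hall i).apply_eq_self_iff.2 hi)
  rw [hc.cycleType, hsupp]
  simp

lemma eval_one_reducedCharpoly_of_cycleType_ne (hn : 2 ≤ n) (σ : Equiv.Perm (Fin n))
    (h : σ.cycleType ≠ {n}) : (reducedCharpoly σ).eval 1 = 0 := by
  contrapose! h
  refine cycleType_of_forall_invariant hn σ fun s hs hne => ?_
  by_contra hs'
  exact h (eval_one_reducedCharpoly_eq_zero (by omega) σ s hs hne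
    (Set.nonempty_compl.2 hs'))

open Classical in
lemma negativeCycle_indicator (hn : 2 ≤ n) (g : SignedPerm n) :
    (1 - ((signProduct g : ℤ) : ℚ)) * (reducedCharpoly g.right).eval 1 =
      if IsNegativeCycle g then (2 * n : ℚ) else 0 := by
  by_cases h : g.right.cycleType = {n}
  · obtain ⟨hc, hs⟩ := isCycle_and_support_of_cycleType h
    rw [eval_one_reducedCharpoly_of_isCycle (by omega) _ hc hs]
    rcases Int.units_eq_one_or (signProduct g) with hg | hg
    · simp [IsNegativeCycle, hg, show ¬ (1 : ℤˣ) = -1 by decide]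
    · simp [IsNegativeCycle, hg, h]
      norm_num
  · simp [eval_one_reducedCharpoly_of_cycleType_ne hn _ h, IsNegativeCycle, h]

open Classical in
lemma sum_isNegativeCycle_prod (hn : 2 ≤ n) (k : ℕ) :
    ∑ t : Fin k → Fin n × Fin n,
      (if IsNegativeCycle (List.ofFn fun i => signedReflection (t i)).prod then (2 * n : ℚ) else 0)
      = (weightedCharpolySum n k 1).eval 1 - (weightedCharpolySum n k (-1)).eval 1 := by
  rw [weightedCharpolySum, weightedCharpolySum, eval_finsetSum, eval_finsetSum,
    ← Finset.sum_sub_distrib]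
  refine Finset.sum_congr rfl fun t _ => ?_
  have h1 : (List.ofFn fun i => signedReflection (t i)).prod.right =
      (List.ofFn fun i => Equiv.swap (t i).1 (t i).2).prod := by
    have := map_list_prod (SemidirectProduct.rightHom (N := Fin n → ℤˣ) (φ := mulAutArrow))
      (List.ofFn fun i => signedReflection (t i))
    rw [List.map_ofFn] at this
    exact this
  have h2 : ((signProduct (List.ofFn fun i => signedReflection (t i)).prod : ℤ) : ℚ) =
      ∏ i, diagWeight (-1) (t i) := by
    rw [map_list_prod, List.map_ofFn, List.prod_ofFn]
    simp [signProduct_signedReflection]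
  rw [← negativeCycle_indicator hn, h1, h2, eval_smul, eval_smul]
  simp [diagWeight]
  ring

lemma not_isNegativeCycle_prod (hn : 2 ≤ n) {k : ℕ} (hk : k < n) (t : Fin k → Fin n × Fin n) :
    ¬ IsNegativeCycle (List.ofFn fun i => signedReflection (t i)).prod := by
  classical
  intro h
  have hsum := sum_isNegativeCycle_prod hn k
  rw [eval_weightedCharpolySum_sub_of_lt hk] at hsum
  rw [Finset.sum_eq_zero_iff_of_nonneg (fun _ _ => by split_ifs <;> positivity)] at hsum
  have := hsum t (Finset.mem_univ t)
  rw [if_pos h] at this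
  have : (n : ℚ) ≠ 0 := by exact_mod_cast (by omega : n ≠ 0)
  simp_all

lemma card_isNegativeCycle_prod (hn : 2 ≤ n) :
    (Nat.card {t : Fin n → Fin n × Fin n //
      IsNegativeCycle (List.ofFn fun i => signedReflection (t i)).prod} : ℚ) * (2 * n) =
      (2 * n) ^ n * n.factorial := by
  classical
  rw [← eval_weightedCharpolySum_sub_self (by omega), ← sum_isNegativeCycle_prod hn,
    Nat.card_eq_fintype_card, Fintype.card_subtype, ← Finset.sum_filter, Finset.sum_const,
    nsmul_eq_mul]

end SignedPermutations

section Factorizations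

lemma card_factorizations_mulEquiv {G H : Type*} [Group G] [Group H] (e : G ≃* H)
    (P : G → Prop) (Q : H → Prop) (h : ∀ x, P x ↔ Q (e x)) (n : ℕ) (g : G) :
    Nat.card {t : Fin n → G // (∀ i, P (t i)) ∧ (List.ofFn t).prod = g} =
      Nat.card {t : Fin n → H // (∀ i, Q (t i)) ∧ (List.ofFn t).prod = e g} := by
  refine Nat.card_congr ((Equiv.arrowCongr (Equiv.refl (Fin n)) e.toEquiv).subtypeEquiv ?_)
  intro t
  have hp : (List.ofFn (Equiv.arrowCongr (Equiv.refl (Fin n)) e.toEquiv t)).prod =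
      e (List.ofFn t).prod := by
    rw [map_list_prod, List.map_ofFn]
    rfl
  rw [hp, e.injective.eq_iff]
  exact and_congr_left fun _ => forall_congr' fun i => h (t i)

end Factorizations

section NegativeCycles

variable {n : ℕ}

lemma inr_conj_signedReflection (σ : Equiv.Perm (Fin n)) (p : Fin n × Fin n) :
    ∃ q, (SemidirectProduct.inr σ * signedReflection p * (SemidirectProduct.inr σ)⁻¹ :
      SignedPerm n) = signedReflection q := by
  obtain ⟨i, j⟩ := p
  have hr : σ * Equiv.swap i j * σ⁻¹ = Equiv.swap (σ i) (σ j) := by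
    rw [Equiv.swap_apply_apply]
  have hσ : ∀ d : Fin n → ℤˣ, (SemidirectProduct.inr σ * ⟨d, Equiv.swap i j⟩ *
      (SemidirectProduct.inr σ)⁻¹ : SignedPerm n) =
      ⟨(mulAutArrow σ : MulAut (Fin n → ℤˣ)) d, Equiv.swap (σ i) (σ j)⟩ := by
    intro d
    apply SemidirectProduct.ext
    · rw [← map_inv]; simp
    · rw [← map_inv]; simpa using hr
  rw [signedReflection, hσ]
  rcases lt_trichotomy i j with h | h | h
  · have hne : σ i ≠ σ j := fun h' => h.ne (σ.injective h')
    rcases lt_or_gt_of_ne hne with h' | h'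
    · exact ⟨(σ i, σ j), by simp [signedReflection, h, h']⟩
    · exact ⟨(σ j, σ i), by simp [signedReflection, h, h', Equiv.swap_comm]⟩
  · subst h
    exact ⟨(σ i, σ i), by simp [signedReflection, mulAutArrow_signFlip]⟩
  · have hne : σ i ≠ σ j := fun h' => h.ne' (σ.injective h')
    rcases lt_or_gt_of_ne hne with h' | h'
    · exact ⟨(σ j, σ i), by
        simp [signedReflection, h.not_gt, h.ne', h'.not_gt, h'.ne', mulAutArrow_signFlip,
          Equiv.swap_comm, mul_comm]⟩
    · exact ⟨(σ i, σ j), by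
        simp [signedReflection, h.not_gt, h.ne', h'.not_gt, h'.ne', mulAutArrow_signFlip]⟩

lemma mul_mulAutArrow_swap_inv {i j : Fin n} (hij : i ≠ j) (d : Fin n → ℤˣ) :
    d * ((mulAutArrow (Equiv.swap i j) : MulAut (Fin n → ℤˣ)) d)⁻¹ =
      if d i = d j then 1 else signFlip i * signFlip j := by
  ext1 k
  rw [Pi.mul_apply, Pi.inv_apply, mulAutArrow_perm_apply, Equiv.swap_inv]
  by_cases hi : k = i
  · subst hi
    rcases Int.units_eq_one_or (d k) with h1 | h1 <;> rcases Int.units_eq_one_or (d j) with h2 | h2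
      <;> simp [h1, h2, signFlip, hij, show ¬ (1 : ℤˣ) = -1 by decide,
        show ¬ (-1 : ℤˣ) = 1 by decide]
  · by_cases hj : k = j
    · subst hj
      rcases Int.units_eq_one_or (d k) with h1 | h1 <;>
        rcases Int.units_eq_one_or (d i) with h2 | h2
        <;> simp [h1, h2, signFlip, hij.symm, show ¬ (1 : ℤˣ) = -1 by decide,
          show ¬ (-1 : ℤˣ) = 1 by decide]
    · rw [Equiv.swap_apply_of_ne_of_ne hi hj]
      split_ifs <;> simp [signFlip, hi, hj]

lemma inl_conj_signedReflection (d : Fin n → ℤˣ) (p : Fin n × Fin n) :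
    ∃ q, (SemidirectProduct.inl d * signedReflection p * (SemidirectProduct.inl d)⁻¹ :
      SignedPerm n) = signedReflection q := by
  have hd : ∀ (ε : Fin n → ℤˣ) (τ : Equiv.Perm (Fin n)), (SemidirectProduct.inl d * ⟨ε, τ⟩ *
      (SemidirectProduct.inl d)⁻¹ : SignedPerm n) =
      ⟨d * ((mulAutArrow τ : MulAut (Fin n → ℤˣ)) d)⁻¹ * ε, τ⟩ := by
    intro ε τ
    apply SemidirectProduct.ext
    · rw [← map_inv]; simp; exact mul_right_comm _ _ _
    · rw [← map_inv]; simp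
  obtain ⟨i, j⟩ := p
  rw [signedReflection, hd]
  by_cases hij : i = j
  · subst hij
    have hself : (mulAutArrow (Equiv.swap i i) : MulAut (Fin n → ℤˣ)) d = d := by
      rw [Equiv.swap_self]
      rfl
    exact ⟨(i, i), by rw [signedReflection, hself]; simp⟩
  · rw [mul_mulAutArrow_swap_inv hij]
    have hflip : signFlip i * signFlip j * (signFlip i * signFlip j) = 1 := by
      rw [mul_mul_mul_comm, signFlip_mul_self, signFlip_mul_self, one_mul]
    split_ifs with h1 h2 h2
    · exact ⟨(i, j), by rw [signedReflection, if_pos h2, one_mul]⟩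
    · exact ⟨(i, j), by rw [signedReflection, if_neg h2, if_neg hij, one_mul]⟩
    · refine ⟨(j, i), ?_⟩
      have h2 : i < j := h2
      simp [signedReflection, h2.not_gt, h2.ne', Equiv.swap_comm, mul_comm]
    · refine ⟨(j, i), ?_⟩
      have h2 : j < i := lt_of_le_of_ne (not_lt.1 h2) (Ne.symm hij)
      simp [signedReflection, h2, hflip, Equiv.swap_comm]

lemma conj_signedReflection (g : SignedPerm n) (p : Fin n × Fin n) :
    ∃ q, g * signedReflection p * g⁻¹ = signedReflection q := by
  obtain ⟨q, hq⟩ := inr_conj_signedReflection g.right p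
  obtain ⟨r, hr⟩ := inl_conj_signedReflection g.left q
  refine ⟨r, ?_⟩
  rw [← hr, ← hq]
  conv_lhs => rw [← SemidirectProduct.inl_left_mul_inr_right g]
  group

lemma conj_mem_range_signedReflection_iff (g x : SignedPerm n) :
    g * x * g⁻¹ ∈ Set.range signedReflection ↔ x ∈ Set.range signedReflection := by
  constructor
  · rintro ⟨p, hp⟩
    obtain ⟨q, hq⟩ := conj_signedReflection g⁻¹ p
    exact ⟨q, by rw [← hq, hp]; group⟩
  · rintro ⟨p, rfl⟩
    obtain ⟨q, hq⟩ := conj_signedReflection g p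
    exact ⟨q, hq.symm⟩

lemma eq_of_mulAutArrow_eq_self {σ : Equiv.Perm (Fin n)} (h : σ.cycleType = {n})
    {a : Fin n → ℤˣ} (ha : (mulAutArrow σ : MulAut (Fin n → ℤˣ)) a = a) (i j : Fin n) :
    a i = a j := by
  obtain ⟨hc, hs⟩ := isCycle_and_support_of_cycleType h
  have hmove : ∀ k, σ k ≠ k := fun k => by
    rw [← Equiv.Perm.mem_support, hs]; exact Finset.mem_univ k
  have hstep : ∀ k, a (σ k) = a k := fun k =>
    (congrFun ha (σ k)).symm.trans (congrArg a (σ.symm_apply_apply k))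
  have hpow : ∀ (m : ℕ) k, a ((σ ^ m) k) = a k := by
    intro m
    induction m with
    | zero => simp
    | succ m ih =>
      intro k
      rw [pow_succ', Equiv.Perm.mul_apply, hstep, ih]
  obtain ⟨m, hm⟩ := (hc.sameCycle (hmove j) (hmove i)).exists_nat_pow_eq
  rw [← hm, hpow]

/-- The homomorphism taking the product of a sign vector. -/
def signVectorProd : (Fin n → ℤˣ) →* ℤˣ where
  toFun d := ∏ i, d i
  map_one' := by simp
  map_mul' d e := by simp [Finset.prod_mul_distrib]

lemma card_ker_signVectorProd (hn : 2 ≤ n) :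
    Nat.card (signVectorProd (n := n)).ker * 2 = 2 ^ n := by
  have hsurj : Function.Surjective (signVectorProd (n := n)) := by
    intro u
    rcases Int.units_eq_one_or u with rfl | rfl
    · exact ⟨1, map_one _⟩
    · exact ⟨signFlip ⟨0, by omega⟩, prod_signFlip _⟩
  have := (signVectorProd (n := n)).ker.card_mul_index
  rw [Subgroup.index_ker, MonoidHom.range_eq_top.2 hsurj, Subgroup.card_top] at this
  simpa [Nat.card_eq_fintype_card] using this

lemma exists_mul_mulAutArrow_inv (hn : 2 ≤ n) {σ : Equiv.Perm (Fin n)} (h : σ.cycleType = {n})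
    {d : Fin n → ℤˣ} (hd : ∏ i, d i = 1) :
    ∃ a : Fin n → ℤˣ, a * ((mulAutArrow σ : MulAut (Fin n → ℤˣ)) a)⁻¹ = d := by
  let ψ : (Fin n → ℤˣ) →* (Fin n → ℤˣ) :=
    { toFun := fun a => a * ((mulAutArrow σ : MulAut (Fin n → ℤˣ)) a)⁻¹
      map_one' := by simp
      map_mul' := fun a b => by
        rw [map_mul, mul_inv, mul_mul_mul_comm] }
  have hker : Nat.card ψ.ker ≤ 2 := by
    have hinj : Function.Injective (fun a : ψ.ker => (a : Fin n → ℤˣ) ⟨0, by omega⟩) := by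
      intro a b hab
      have hconst : ∀ (a : ψ.ker) (i j : Fin n), (a : Fin n → ℤˣ) i = (a : Fin n → ℤˣ) j :=
        fun a => eq_of_mulAutArrow_eq_self h (mul_inv_eq_one.1 a.2).symm
      ext1
      funext i
      rw [hconst a i ⟨0, by omega⟩, hconst b i ⟨0, by omega⟩]
      exact hab
    simpa [Nat.card_eq_fintype_card] using Nat.card_le_card_of_injective _ hinj
  have hle : ψ.range ≤ (signVectorProd (n := n)).ker := by
    rintro _ ⟨a, rfl⟩
    change ∏ i, (a * ((mulAutArrow σ : MulAut (Fin n → ℤˣ)) a)⁻¹) i = 1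
    simp only [Pi.mul_apply, Pi.inv_apply, mulAutArrow_perm_apply, Finset.prod_mul_distrib,
      Finset.prod_inv_distrib]
    rw [Equiv.prod_comp (σ⁻¹) a, mul_inv_cancel]
  have hcard := ψ.ker.card_mul_index
  rw [Subgroup.index_ker] at hcard
  have hk := card_ker_signVectorProd hn
  have hG : Nat.card (Fin n → ℤˣ) = 2 ^ n := by simp [Nat.card_eq_fintype_card]
  have heq : ψ.range = (signVectorProd (n := n)).ker := by
    apply Subgroup.eq_of_le_of_card_ge hle
    have := Nat.mul_le_mul_right (Nat.card ψ.range) hker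
    rw [hcard, hG, ← hk] at this
    omega
  have : d ∈ ψ.range := by rw [heq]; exact hd
  exact this

lemma IsNegativeCycle.isConj (hn : 2 ≤ n) {g h : SignedPerm n} (hg : IsNegativeCycle g)
    (hh : IsNegativeCycle h) : IsConj g h := by
  obtain ⟨c, hc⟩ := isConj_iff.1 (Equiv.Perm.isConj_iff_cycleType_eq.2 (hg.1.trans hh.1.symm))
  set g' : SignedPerm n := SemidirectProduct.inr c * g * (SemidirectProduct.inr c)⁻¹ with hg'
  have hright : g'.right = h.right := by
    rw [← hc, hg', ← map_inv]
    simp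
  have hsign : signProduct g' = -1 := by
    rw [hg', map_mul, map_mul, map_inv, mul_inv_cancel_comm, hg.2]
  obtain ⟨a, ha⟩ := exists_mul_mulAutArrow_inv hn hh.1 (d := h.left * g'.left⁻¹) (by
    have h1 : ∏ i, g'.left i = -1 := hsign
    have h2 : ∏ i, h.left i = -1 := hh.2
    simp [Finset.prod_mul_distrib, h1, h2])
  refine (isConj_iff.2 ⟨SemidirectProduct.inr c, rfl⟩ : IsConj g g').trans
    (isConj_iff.2 ⟨SemidirectProduct.inl a, ?_⟩)
  rw [← map_inv]
  apply SemidirectProduct.ext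
  · have h1 : a * g'.left * ((mulAutArrow h.right : MulAut (Fin n → ℤˣ)) a)⁻¹ = h.left := by
      rw [mul_right_comm, ha, inv_mul_cancel_right]
    simpa [hright] using h1
  · simpa using hright

lemma card_prod_eq_neg_one (hn : 2 ≤ n) :
    Nat.card {d : Fin n → ℤˣ // ∏ i, d i = -1} * 2 = 2 ^ n := by
  rw [← card_ker_signVectorProd hn]
  congr 1
  refine Nat.card_congr ((Equiv.mulRight (signFlip ⟨0, by omega⟩)).subtypeEquiv fun d => ?_)
  change _ ↔ ∏ i, (d * signFlip (⟨0, by omega⟩ : Fin n) : Fin n → ℤˣ) i = 1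
  simp only [Pi.mul_apply, Finset.prod_mul_distrib, prod_signFlip]
  rcases Int.units_eq_one_or (∏ i, d i) with h | h <;> rw [h] <;> decide

lemma card_isNegativeCycle (hn : 2 ≤ n) :
    Nat.card {g : SignedPerm n // IsNegativeCycle g} * 2 = 2 ^ n * (n - 1).factorial := by
  have e : {g : SignedPerm n // IsNegativeCycle g} ≃
      {d : Fin n → ℤˣ // ∏ i, d i = -1} × {σ : Equiv.Perm (Fin n) // σ.cycleType = {n}} :=
    { toFun := fun g => (⟨g.1.left, g.2.2⟩, ⟨g.1.right, g.2.1⟩)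
      invFun := fun p => ⟨⟨p.1.1, p.2.1⟩, p.2.2, p.1.2⟩
      left_inv := fun _ => rfl
      right_inv := fun _ => rfl }
  have h2 : Nat.card {σ : Equiv.Perm (Fin n) // σ.cycleType = {n}} = (n - 1).factorial := by
    rw [Nat.card_eq_fintype_card, Fintype.card_subtype,
      Equiv.Perm.card_of_cycleType_singleton hn (by simp)]
    simp
  rw [Nat.card_congr e, Nat.card_prod, h2, mul_right_comm, card_prod_eq_neg_one hn]

/-- The number of ways to write a negative cycle as a product of `n` reflections. -/
lemma card_factorizations_of_isNegativeCycle (hn : 2 ≤ n) {g : SignedPerm n}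
    (hg : IsNegativeCycle g) :
    Nat.card {t : Fin n → SignedPerm n //
      (∀ i, t i ∈ Set.range signedReflection) ∧ (List.ofFn t).prod = g} = n ^ n := by
  classical
  have : Finite (SignedPerm n) := Finite.of_equiv _ SemidirectProduct.equivProd.symm
  have := Fintype.ofFinite (SignedPerm n)
  set N := Nat.card {t : Fin n → SignedPerm n //
      (∀ i, t i ∈ Set.range signedReflection) ∧ (List.ofFn t).prod = g} with hN
  have hconst : ∀ h : {h : SignedPerm n // IsNegativeCycle h},
      Nat.card {t : Fin n → Fin n × Fin n //
        (List.ofFn fun i => signedReflection (t i)).prod = h} = N := by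
    rintro ⟨h, hh⟩
    obtain ⟨c, hc⟩ := isConj_iff.1 (hg.isConj hn hh)
    rw [hN, card_factorizations_mulEquiv (MulAut.conj c) _ (fun x => x ∈ Set.range signedReflection)
      (fun x => (conj_mem_range_signedReflection_iff c x).symm) n g, MulAut.conj_apply, hc]
    refine Nat.card_congr (Equiv.ofBijective
      (fun t => ⟨fun i => signedReflection (t.1 i), fun i => ⟨_, rfl⟩, t.2⟩) ⟨?_, ?_⟩)
    · intro s t hst
      ext1
      funext i
      exact signedReflection_injective (congrFun (congrArg Subtype.val hst) i)
    · rintro ⟨t, ht, hp⟩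
      have ht' := ht
      choose p hp' using ht'
      obtain rfl : (fun i => signedReflection (p i)) = t := funext hp'
      exact ⟨⟨p, hp⟩, rfl⟩
  have e : {t : Fin n → Fin n × Fin n //
      IsNegativeCycle (List.ofFn fun i => signedReflection (t i)).prod} ≃
      Σ h : {h : SignedPerm n // IsNegativeCycle h}, {t : Fin n → Fin n × Fin n //
        (List.ofFn fun i => signedReflection (t i)).prod = h} :=
    { toFun := fun t => ⟨⟨_, t.2⟩, t.1, rfl⟩
      invFun := fun x => ⟨x.2.1, by rw [x.2.2]; exact x.1.2⟩
      left_inv := fun _ => rfl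
      right_inv := by
        rintro ⟨⟨h, hh⟩, t, ht⟩
        have ht' : _ = h := ht
        subst ht'
        rfl }
  have hsum : Nat.card {t : Fin n → Fin n × Fin n //
      IsNegativeCycle (List.ofFn fun i => signedReflection (t i)).prod} =
      Nat.card {h : SignedPerm n // IsNegativeCycle h} * N := by
    rw [Nat.card_congr e, Nat.card_sigma, Finset.sum_congr rfl fun h _ => hconst h,
      Finset.sum_const, Finset.card_univ, smul_eq_mul, Nat.card_eq_fintype_card]
  have htotal := card_isNegativeCycle_prod hn
  rw [hsum] at htotal
  have hclass := card_isNegativeCycle hn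
  have hfact : n * (n - 1).factorial = n.factorial := Nat.mul_factorial_pred (by omega)
  have htotal' : Nat.card {h : SignedPerm n // IsNegativeCycle h} * N * (2 * n) =
      (2 * n) ^ n * n.factorial := by exact_mod_cast htotal
  have hpos : 0 < 2 ^ n * n.factorial := by positivity
  refine Nat.eq_of_mul_eq_mul_left hpos ?_
  calc 2 ^ n * n.factorial * N
      = Nat.card {h : SignedPerm n // IsNegativeCycle h} * 2 * n * N := by
        rw [hclass, ← hfact]; ring
    _ = Nat.card {h : SignedPerm n // IsNegativeCycle h} * N * (2 * n) := by ring
    _ = 2 ^ n * n.factorial * n ^ n := by rw [htotal', mul_pow]; ring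

end NegativeCycles

section CosetWalk

variable {G : Type*} [Group G]

/-- The indices `m, m - 1, …, 1, 0, 1, …, m` of the letters of the longest minimal coset
representative of `B_m` in `B_{m+1}`. -/
def walkIndex (m j : ℕ) : ℕ := (m - j) + (j - m)

/-- The minimal coset representatives of `B_m` in `B_{m+1}`, with respect to generators `b` whose
first two satisfy the braid relation of length four. -/
def cosetWalk (b : ℕ → G) (m : ℕ) : ℕ → G
  | 0 => 1
  | j + 1 => b (walkIndex m j) * cosetWalk b m j

/-- The relations of type `B` between `b 0, …, b (n - 1)`. -/
structure TypeBRelations (b : ℕ → G) (n : ℕ) : Prop where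
  mul_self : ∀ i < n, b i * b i = 1
  commute : ∀ i < n, ∀ j < n, i + 2 ≤ j → b i * b j = b j * b i
  braid_three : ∀ i, 1 ≤ i → i + 1 < n → b i * b (i + 1) * b i = b (i + 1) * b i * b (i + 1)
  braid_four : 1 < n → b 0 * b 1 * b 0 * b 1 = b 1 * b 0 * b 1 * b 0

lemma TypeBRelations.exists_mul_cosetWalk {b : ℕ → G} {n m : ℕ} (h : TypeBRelations b n)
    (hm : m < n) (j : ℕ) : ∀ i ≤ m, j ≤ 2 * m + 1 → i ≠ walkIndex m j →
      (∀ k, j = k + 1 → i ≠ walkIndex m k) →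
      ∃ i' < m, b i * cosetWalk b m j = cosetWalk b m j * b i' := by
  induction j using Nat.strong_induction_on with
  | _ j ih =>
  intro i hi hj hij hij'
  rcases j with _ | j
  · refine ⟨i, ?_, by simp [cosetWalk]⟩
    simp only [walkIndex] at hij
    omega
  have hne := hij' j rfl
  have hkm : walkIndex m j ≤ m := by simp only [walkIndex]; omega
  by_cases hfar : i + 2 ≤ walkIndex m j ∨ walkIndex m j + 2 ≤ i
  · have hcomm : b i * b (walkIndex m j) = b (walkIndex m j) * b i := by
      rcases hfar with hfar | hfar
      · exact h.commute _ (by omega) _ (by omega) hfar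
      · exact (h.commute _ (by omega) _ (by omega) hfar).symm
    obtain ⟨i', hi', he⟩ := ih j (by omega) i hi (by omega) hne (by
      rintro k rfl
      simp only [walkIndex] at *
      omega)
    refine ⟨i', hi', ?_⟩
    rw [cosetWalk, ← mul_assoc, hcomm, mul_assoc, he, mul_assoc]
  · rcases j with _ | j
    · simp only [walkIndex] at *
      omega
    have hi2 : i = walkIndex m j := by
      simp only [walkIndex] at *
      omega
    by_cases hz : i = 0
    · rcases j with _ | j
      · simp only [walkIndex] at *
        omega
      have e1 : walkIndex m (j + 1 + 1) = 1 := by simp only [walkIndex] at *; omega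
      have e2 : walkIndex m (j + 1) = 0 := by simp only [walkIndex] at *; omega
      have e3 : walkIndex m j = 1 := by simp only [walkIndex] at *; omega
      obtain ⟨i', hi', he⟩ := ih j (by omega) 0 (by omega) (by omega) (by omega) (by
        rintro k rfl
        simp only [walkIndex] at *
        omega)
      refine ⟨i', hi', ?_⟩
      rw [hz, cosetWalk, cosetWalk, cosetWalk, e1, e2, e3]
      have hb := h.braid_four (by simp only [walkIndex] at *; omega)
      calc b 0 * (b 1 * (b 0 * (b 1 * cosetWalk b m j)))
          = b 0 * b 1 * b 0 * b 1 * cosetWalk b m j := by simp only [mul_assoc]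
        _ = b 1 * b 0 * b 1 * (b 0 * cosetWalk b m j) := by rw [hb]; simp only [mul_assoc]
        _ = _ := by rw [he]; simp only [mul_assoc]
    · have hb : b i * b (walkIndex m (j + 1)) * b i =
          b (walkIndex m (j + 1)) * b i * b (walkIndex m (j + 1)) := by
        have : walkIndex m (j + 1) = i + 1 ∨ i = walkIndex m (j + 1) + 1 := by
          simp only [walkIndex] at *
          omega
        rcases this with h1 | h1
        · rw [h1]
          exact h.braid_three i (by omega) (by omega)
        · have h2 : 1 ≤ walkIndex m (j + 1) := by
            simp only [walkIndex] at *
            omega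
          have := h.braid_three (walkIndex m (j + 1)) h2 (by omega)
          rw [← h1] at this
          exact this.symm
      obtain ⟨i', hi', he⟩ := ih j (by omega) (walkIndex m (j + 1)) (by omega) (by omega)
        (by simp only [walkIndex] at *; omega) (by
          rintro k rfl
          simp only [walkIndex] at *
          omega)
      refine ⟨i', hi', ?_⟩
      rw [cosetWalk, cosetWalk, ← hi2]
      calc b i * (b (walkIndex m (j + 1)) * (b i * cosetWalk b m j))
          = b i * b (walkIndex m (j + 1)) * b i * cosetWalk b m j := by simp only [mul_assoc]
        _ = b (walkIndex m (j + 1)) * b i * (b (walkIndex m (j + 1)) * cosetWalk b m j) := by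
          rw [hb]; simp only [mul_assoc]
        _ = _ := by rw [he]; simp only [mul_assoc]

lemma TypeBRelations.exists_mem_closure {b : ℕ → G} {n m : ℕ} (h : TypeBRelations b n)
    (hm : m < n) {g : G} (hg : g ∈ Subgroup.closure (b '' Set.Iio (m + 1))) :
    ∃ j < 2 * m + 2, ∃ x ∈ Subgroup.closure (b '' Set.Iio m), g = cosetWalk b m j * x := by
  have hstep : ∀ i ≤ m, ∀ j < 2 * m + 2, ∃ j' < 2 * m + 2,
      ∃ x ∈ Subgroup.closure (b '' Set.Iio m),
        b i * cosetWalk b m j = cosetWalk b m j' * x := by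
    intro i hi j hj
    by_cases h1 : i = walkIndex m j
    · refine ⟨j + 1, ?_, 1, one_mem _, by rw [cosetWalk, h1, mul_one]⟩
      simp only [walkIndex] at h1
      omega
    by_cases h2 : ∃ k, j = k + 1 ∧ i = walkIndex m k
    · obtain ⟨k, rfl, h2⟩ := h2
      refine ⟨k, by omega, 1, one_mem _, ?_⟩
      rw [cosetWalk, ← h2, ← mul_assoc, h.mul_self i (by omega), one_mul, mul_one]
    · push Not at h2
      obtain ⟨i', hi', he⟩ := h.exists_mul_cosetWalk hm j i hi (by omega) h1 h2
      exact ⟨j, hj, b i', Subgroup.subset_closure ⟨i', hi', rfl⟩, he⟩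
  have hmul : ∀ i ≤ m, ∀ y : G, (∃ j < 2 * m + 2, ∃ x ∈ Subgroup.closure (b '' Set.Iio m),
      y = cosetWalk b m j * x) → ∃ j < 2 * m + 2, ∃ x ∈ Subgroup.closure (b '' Set.Iio m),
      b i * y = cosetWalk b m j * x := by
    rintro i hi _ ⟨j, hj, x, hx, rfl⟩
    obtain ⟨j', hj', x', hx', he⟩ := hstep i hi j hj
    exact ⟨j', hj', x' * x, mul_mem hx' hx, by rw [← mul_assoc, he, mul_assoc]⟩
  induction hg using Subgroup.closure_induction_left with
  | one => exact ⟨0, by omega, 1, one_mem _, by simp [cosetWalk]⟩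
  | mul_left x hx y _ ih =>
    obtain ⟨i, hi, rfl⟩ := hx
    exact hmul i (Nat.lt_succ_iff.1 hi) y ih
  | inv_mul_cancel x hx y _ ih =>
    obtain ⟨i, hi, rfl⟩ := hx
    have hi : i < m + 1 := hi
    rw [inv_eq_of_mul_eq_one_right (h.mul_self i (by omega))]
    exact hmul i (by omega) y ih

lemma TypeBRelations.exists_finset {b : ℕ → G} {n : ℕ} (h : TypeBRelations b n) (m : ℕ)
    (hm : m ≤ n) : ∃ A : Finset G, A.card ≤ 2 ^ m * m.factorial ∧
      ∀ g ∈ Subgroup.closure (b '' Set.Iio m), g ∈ A := by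
  classical
  induction m with
  | zero =>
    refine ⟨{1}, by simp, fun g hg => ?_⟩
    have hempty : b '' Set.Iio 0 = ∅ := by simp
    rw [hempty, Subgroup.closure_empty, Subgroup.mem_bot] at hg
    simp [hg]
  | succ m ih =>
    obtain ⟨A, hA, hA'⟩ := ih (by omega)
    refine ⟨Finset.image₂ (fun j x => cosetWalk b m j * x) (Finset.range (2 * m + 2)) A, ?_, ?_⟩
    · calc _ ≤ (Finset.range (2 * m + 2)).card * A.card := Finset.card_image₂_le _ _ _
        _ ≤ (2 * m + 2) * (2 ^ m * m.factorial) := by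
          rw [Finset.card_range]
          exact Nat.mul_le_mul_left _ hA
        _ = 2 ^ (m + 1) * (m + 1).factorial := by
          rw [Nat.factorial_succ, pow_succ]
          ring
    · intro g hg
      obtain ⟨j, hj, x, hx, rfl⟩ := h.exists_mem_closure (by omega) hg
      exact Finset.mem_image₂_of_mem (Finset.mem_range.2 hj) (hA' x hx)

lemma TypeBRelations.card_le [Finite G] {b : ℕ → G} {n : ℕ} (h : TypeBRelations b n)
    (htop : Subgroup.closure (b '' Set.Iio n) = ⊤) : Nat.card G ≤ 2 ^ n * n.factorial := by
  have := Fintype.ofFinite G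
  obtain ⟨A, hA, hA'⟩ := h.exists_finset n le_rfl
  have huniv : A = Finset.univ := Finset.eq_univ_iff_forall.2 fun g => hA' g (by simp [htop])
  rwa [huniv, Finset.card_univ, ← Nat.card_eq_fintype_card] at hA

end CosetWalk

section Generators

variable {n : ℕ}

/-- The simple reflections of the hyperoctahedral group: the adjacent transpositions, and the sign
change at the last position. -/
def signedGenerator (i : Fin n) : SignedPerm n :=
  signedReflection (i, ⟨min (i + 1) (n - 1), by omega⟩)

lemma signedGenerator_of_lt {i : Fin n} (h : (i : ℕ) + 1 < n) :
    signedGenerator i = SemidirectProduct.inr (Equiv.swap i ⟨i + 1, h⟩) := by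
  have h1 : (⟨min (i + 1) (n - 1), by omega⟩ : Fin n) = ⟨i + 1, h⟩ := by
    ext1
    change min ((i : ℕ) + 1) (n - 1) = i + 1
    omega
  have h2 : i < (⟨i + 1, h⟩ : Fin n) := Nat.lt_succ_self _
  rw [signedGenerator, h1, signedReflection, if_pos h2]
  rfl

lemma signedGenerator_last {i : Fin n} (h : ¬ (i : ℕ) + 1 < n) :
    signedGenerator i = SemidirectProduct.inl (signFlip i) := by
  have h1 : (⟨min (i + 1) (n - 1), by omega⟩ : Fin n) = i := by
    ext1
    change min ((i : ℕ) + 1) (n - 1) = i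
    omega
  rw [signedGenerator, h1, signedReflection, if_neg (lt_irrefl _), if_pos rfl, Equiv.swap_self]
  rfl

lemma signedGenerator_injective : Function.Injective (signedGenerator : Fin n → SignedPerm n) :=
  fun _ _ h => congrArg Prod.fst (signedReflection_injective h)

lemma inr_mul_inl (σ : Equiv.Perm (Fin n)) (d : Fin n → ℤˣ) :
    (SemidirectProduct.inr σ * SemidirectProduct.inl d : SignedPerm n) =
      SemidirectProduct.inl ((mulAutArrow σ : MulAut (Fin n → ℤˣ)) d) *
        SemidirectProduct.inr σ := by
  apply SemidirectProduct.ext <;> simp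

lemma signedGenerator_mul_self (i : Fin n) : signedGenerator i * signedGenerator i = 1 := by
  by_cases h : (i : ℕ) + 1 < n
  · rw [signedGenerator_of_lt h, ← map_mul, Equiv.swap_mul_self, map_one]
  · rw [signedGenerator_last h, ← map_mul, signFlip_mul_self, map_one]

lemma signedGenerator_commute {i j : Fin n} (hij : (i : ℕ) + 2 ≤ j) :
    Commute (signedGenerator i) (signedGenerator j) := by
  have hi : (i : ℕ) + 1 < n := by omega
  rw [signedGenerator_of_lt hi]
  by_cases hj : (j : ℕ) + 1 < n
  · rw [signedGenerator_of_lt hj]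
    refine Commute.map (Equiv.Perm.Disjoint.commute ?_) _
    rw [Equiv.Perm.disjoint_iff_disjoint_support, Equiv.Perm.support_swap (by simp [Fin.ext_iff]),
      Equiv.Perm.support_swap (by simp [Fin.ext_iff])]
    simp only [Finset.disjoint_left, Finset.mem_insert, Finset.mem_singleton, Fin.ext_iff]
    omega
  · rw [signedGenerator_last hj, Commute, SemiconjBy, inr_mul_inl, mulAutArrow_signFlip,
      Equiv.swap_apply_of_ne_of_ne (by simp only [ne_eq, Fin.ext_iff]; omega)
        (by simp only [ne_eq, Fin.ext_iff]; omega)]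

lemma signedGenerator_pow_three {i j : Fin n} (hij : (i : ℕ) + 1 = j) (hj : (j : ℕ) + 1 < n) :
    (signedGenerator i * signedGenerator j) ^ 3 = 1 := by
  have hj' : (⟨i + 1, by omega⟩ : Fin n) = j := Fin.ext hij
  rw [signedGenerator_of_lt (by omega : (i : ℕ) + 1 < n), signedGenerator_of_lt hj, hj', ← map_mul,
    ← map_pow, Equiv.swap_comm i j]
  have h3 := Equiv.Perm.isThreeCycle_swap_mul_swap_same (a := j) (b := i) (c := ⟨j + 1, hj⟩)
    (by simp only [ne_eq, Fin.ext_iff]; omega) (by simp only [ne_eq, Fin.ext_iff]; omega)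
    (by simp only [ne_eq, Fin.ext_iff]; omega)
  rw [← h3.orderOf, pow_orderOf_eq_one, map_one]

lemma signedGenerator_pow_four {i j : Fin n} (hij : (i : ℕ) + 1 = j) (hj : ¬ (j : ℕ) + 1 < n) :
    (signedGenerator i * signedGenerator j) ^ 4 = 1 := by
  have hj' : (⟨i + 1, by omega⟩ : Fin n) = j := Fin.ext hij
  rw [signedGenerator_of_lt (by omega : (i : ℕ) + 1 < n), signedGenerator_last hj, hj']
  have h2 : (SemidirectProduct.inr (Equiv.swap i j) * SemidirectProduct.inl (signFlip j) :
      SignedPerm n) ^ 2 = SemidirectProduct.inl (signFlip i * signFlip j) := by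
    rw [pow_two]
    nth_rewrite 1 [inr_mul_inl]
    rw [mulAutArrow_signFlip, Equiv.swap_apply_right, mul_assoc, ← mul_assoc (SemidirectProduct.inr _),
      ← map_mul, Equiv.swap_mul_self, map_one, one_mul, map_mul]
  rw [show 4 = 2 * 2 from rfl, pow_mul, h2, pow_two, ← map_mul, mul_mul_mul_comm,
    signFlip_mul_self, signFlip_mul_self, one_mul, map_one]

lemma mul_pow_eq_one_comm {G : Type*} [Group G] {a b : G} {k : ℕ} (h : (a * b) ^ k = 1) :
    (b * a) ^ k = 1 := by
  apply mul_left_cancel (a := a)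
  rw [← mul_pow_mul, h, one_mul, mul_one]

lemma signedGenerator_isLiftable {M : CoxeterMatrix (Fin n)}
    (hM : ∀ i j : Fin n, M i j =
      if i = j then 1
      else if (i : ℕ) + 1 = (j : ℕ) ∨ (j : ℕ) + 1 = (i : ℕ) then
        (if (i : ℕ) = n - 1 ∨ (j : ℕ) = n - 1 then 4 else 3)
      else 2) : M.IsLiftable (signedGenerator : Fin n → SignedPerm n) := by
  have key : ∀ i j : Fin n, i ≤ j → (signedGenerator i * signedGenerator j) ^ M i j = 1 := by
    intro i j hij
    have hij' : (i : ℕ) ≤ j := hij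
    rw [hM]
    split_ifs with h1 h2 h3
    · rw [h1, pow_one, signedGenerator_mul_self]
    · exact signedGenerator_pow_four (by omega) (by omega)
    · exact signedGenerator_pow_three (by omega) (by omega)
    · have hne : (i : ℕ) ≠ j := fun h => h1 (Fin.ext h)
      rw [(signedGenerator_commute (by omega)).mul_pow, pow_two, pow_two,
        signedGenerator_mul_self, signedGenerator_mul_self, one_mul]
  intro i j
  rcases le_total i j with h | h
  · exact key i j h
  · rw [M.symmetric]
    exact mul_pow_eq_one_comm (key j i h)

lemma closure_range_signedGenerator :
    Subgroup.closure (Set.range (signedGenerator : Fin n → SignedPerm n)) = ⊤ := by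
  set K := Subgroup.closure (Set.range (signedGenerator : Fin n → SignedPerm n)) with hK
  have hgen : ∀ i, signedGenerator i ∈ K := fun i => Subgroup.subset_closure ⟨i, rfl⟩
  have hperm : ∀ σ : Equiv.Perm (Fin n), SemidirectProduct.inr σ ∈ K := by
    rcases n with _ | m
    · intro σ
      rw [Subsingleton.elim σ 1, map_one]
      exact one_mem _
    · have hle : Submonoid.closure (Set.range fun i : Fin m => Equiv.swap i.castSucc i.succ) ≤
          (K.comap SemidirectProduct.inr).toSubmonoid := by
        rw [Submonoid.closure_le]
        rintro _ ⟨i, rfl⟩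
        have := hgen i.castSucc
        rw [signedGenerator_of_lt (by simp)] at this
        exact this
      rw [Equiv.Perm.mclosure_swap_castSucc_succ] at hle
      exact fun σ => hle (Submonoid.mem_top σ)
  have hflip : ∀ i : Fin n, SemidirectProduct.inl (signFlip i) ∈ K := by
    intro i
    obtain ⟨l, hl⟩ : ∃ l : Fin n, ¬ (l : ℕ) + 1 < n :=
      ⟨⟨n - 1, by have := i.isLt; omega⟩, by simp only; omega⟩
    have hlast := hgen l
    rw [signedGenerator_last hl] at hlast
    have := mul_mem (mul_mem (hperm (Equiv.swap l i)) hlast) (inv_mem (hperm (Equiv.swap l i)))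
    rwa [inr_mul_inl, mul_inv_cancel_right, mulAutArrow_signFlip, Equiv.swap_apply_left] at this
  have hsign : ∀ d : Fin n → ℤˣ, SemidirectProduct.inl d ∈ K := by
    intro d
    rw [← Finset.univ_prod_mulSingle d]
    change _ ∈ K.comap SemidirectProduct.inl
    refine Subgroup.prod_mem _ fun i _ => ?_
    rcases Int.units_eq_one_or (d i) with h | h
    · rw [h, Pi.mulSingle_one]
      exact one_mem _
    · rw [h]
      exact hflip i
  rw [eq_top_iff]
  intro g _
  rw [← SemidirectProduct.inl_left_mul_inr_right g]
  exact mul_mem (hsign _) (hperm _)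

lemma exists_conj_signedGenerator (hn : 2 ≤ n) (p : Fin n × Fin n) :
    ∃ i : Fin n, IsConj (signedGenerator i) (signedReflection p) := by
  obtain ⟨i, j⟩ := p
  have hswap : ∀ i j : Fin n, i ≠ j → IsConj (signedGenerator (⟨0, by omega⟩ : Fin n))
      (SemidirectProduct.inr (Equiv.swap i j)) := by
    intro i j hij
    have h0 : ((⟨0, by omega⟩ : Fin n) : ℕ) + 1 < n := by simp only; omega
    rw [signedGenerator_of_lt h0]
    exact MonoidHom.map_isConj _ (Equiv.Perm.isConj_swap (by simp [Fin.ext_iff]) hij)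
  rcases lt_trichotomy i j with h | h | h
  · refine ⟨⟨0, by omega⟩, ?_⟩
    rw [signedReflection, if_pos h]
    exact hswap i j h.ne
  · subst h
    refine ⟨⟨n - 1, by omega⟩, isConj_iff.2
      ⟨SemidirectProduct.inr (Equiv.swap ⟨n - 1, by omega⟩ i), ?_⟩⟩
    rw [signedGenerator_last (by simp only; omega), inr_mul_inl, mul_inv_cancel_right,
      mulAutArrow_signFlip, Equiv.swap_apply_left, signedReflection, if_neg (lt_irrefl _),
      if_pos rfl, Equiv.swap_self]
    rfl
  · refine ⟨⟨0, by omega⟩, (hswap i j h.ne').trans (isConj_iff.2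
      ⟨SemidirectProduct.inl (signFlip i), ?_⟩)⟩
    rw [signedReflection, if_neg h.not_gt, if_neg h.ne', mul_assoc, ← map_inv, inr_mul_inl,
      ← mul_assoc, ← map_mul, map_inv, mul_mulAutArrow_swap_inv h.ne', if_neg]
    · exact (SemidirectProduct.mk_eq_inl_mul_inr _ _).symm
    · simp [signFlip, h.ne']

end Generators

section MaximalChains

variable {G : Type*} [Group G] {S : Set G}

lemma absLength_prod_le {l : List G} (hl : ∀ t ∈ l, IsReflectionOf S t) :
    absLength S l.prod ≤ l.length :=
  Nat.sInf_le ⟨l, hl, rfl, rfl⟩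

lemma exists_list_length_eq_absLength {l : List G} (hl : ∀ t ∈ l, IsReflectionOf S t) :
    ∃ l' : List G, (∀ t ∈ l', IsReflectionOf S t) ∧ l'.length = absLength S l.prod ∧
      l'.prod = l.prod :=
  Nat.sInf_mem (s := {k | ∃ l' : List G, (∀ t ∈ l', IsReflectionOf S t) ∧ l'.length = k ∧
    l'.prod = l.prod}) ⟨_, l, hl, rfl, rfl⟩

lemma isReflectionOf_of_absLength_eq_one {x : G} (h : absLength S x = 1) :
    IsReflectionOf S x := by
  have hne : {k | ∃ l : List G, (∀ t ∈ l, IsReflectionOf S t) ∧ l.length = k ∧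
      l.prod = x}.Nonempty := by
    rw [Set.nonempty_iff_ne_empty]
    intro he
    rw [absLength, he, Nat.sInf_empty] at h
    omega
  obtain ⟨l, hl, hlen, hprod⟩ := Nat.sInf_mem hne
  have hlen : l.length = 1 := hlen.trans h
  obtain ⟨t, rfl⟩ := List.length_eq_one_iff.1 hlen
  rw [← hprod, List.prod_singleton]
  exact hl t (by simp)

lemma absLength_prod_of_append {n : ℕ} {c : G}
    (hc : ∀ l : List G, (∀ t ∈ l, IsReflectionOf S t) → l.prod = c → n ≤ l.length)
    {l l' : List G} (hl : ∀ t ∈ l, IsReflectionOf S t) (hl' : ∀ t ∈ l', IsReflectionOf S t)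
    (hprod : (l ++ l').prod = c) (hlen : (l ++ l').length = n) :
    absLength S l.prod = l.length := by
  refine le_antisymm (absLength_prod_le hl) ?_
  obtain ⟨m, hm, hmlen, hmprod⟩ := exists_list_length_eq_absLength hl
  have := hc (m ++ l') (by
    intro t ht
    rcases List.mem_append.1 ht with ht | ht
    · exact hm t ht
    · exact hl' t ht) (by rw [List.prod_append, hmprod, ← List.prod_append, hprod])
  rw [List.length_append] at this hlen
  omega

/-- If the absolute length of `c` is at least `n`, the maximal chains below `c` correspond to the
factorizations of `c` into `n` reflections. -/
lemma maxChainCount_eq_card_factorizations {n : ℕ} {c : G}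
    (hc : ∀ l : List G, (∀ t ∈ l, IsReflectionOf S t) → l.prod = c → n ≤ l.length) :
    maxChainCount S c n =
      Nat.card {t : Fin n → G // (∀ i, IsReflectionOf S (t i)) ∧ (List.ofFn t).prod = c} := by
  have hlast : ∀ t : Fin n → G, Fin.partialProd t (Fin.last n) = (List.ofFn t).prod := by
    intro t
    rw [Fin.partialProd, List.take_of_length_le (by simp)]
  have hleft : ∀ y : Fin (n + 1) → G, y 0 = 1 →
      Fin.partialProd (fun i : Fin n => (y i.castSucc)⁻¹ * y i.succ) = y := by
    intro y hy
    have := Fin.partialProd_left_inv y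
    rwa [hy, one_smul] at this
  have hlength : ∀ t : Fin n → G, (∀ i, IsReflectionOf S (t i)) → (List.ofFn t).prod = c →
      ∀ i : Fin (n + 1), absLength S (Fin.partialProd t i) = i := by
    intro t ht hprod i
    have hmem : ∀ x ∈ List.ofFn t, IsReflectionOf S x := by
      intro x hx
      obtain ⟨j, rfl⟩ := List.mem_ofFn.1 hx
      exact ht j
    rw [Fin.partialProd, absLength_prod_of_append hc (l' := (List.ofFn t).drop i)
      (fun x hx => hmem x (List.mem_of_mem_take hx)) (fun x hx => hmem x (List.mem_of_mem_drop hx))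
      (by rw [List.take_append_drop, hprod]) (by rw [List.take_append_drop, List.length_ofFn]),
      List.length_take, List.length_ofFn]
    omega
  refine Nat.card_congr
    { toFun := fun y => ⟨fun i => (y.1 i.castSucc)⁻¹ * y.1 i.succ, ?_, ?_⟩
      invFun := fun t => ⟨Fin.partialProd t.1, Fin.partialProd_zero _, ?_, ?_, ?_⟩
      left_inv := fun y => Subtype.ext (hleft y.1 y.2.1)
      right_inv := fun t => Subtype.ext (funext fun i => Fin.partialProd_right_inv t.1 i) }
  · intro i
    obtain ⟨y, h0, h1, hle, hlen⟩ := y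
    apply isReflectionOf_of_absLength_eq_one
    have h2 := hle i
    rw [absLe, hlen, hlen] at h2
    simp only [Fin.val_castSucc, Fin.val_succ] at h2
    change absLength S ((y i.castSucc)⁻¹ * y i.succ) = 1
    omega
  · rw [← hlast, hleft _ y.2.1, y.2.2.1]
  · rw [hlast, t.2.2]
  · intro i
    have hlen := hlength t.1 t.2.1 t.2.2
    have hmem : ∀ x ∈ [t.1 i], IsReflectionOf S x := by
      intro x hx
      rw [List.mem_singleton.1 hx]
      exact t.2.1 i
    have hle := absLength_prod_le hmem
    obtain ⟨l, hl, hllen, hlprod⟩ := exists_list_length_eq_absLength hmem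
    rw [List.prod_singleton] at hle hllen hlprod
    have hne : absLength S (t.1 i) ≠ 0 := by
      intro h0
      rw [h0, List.length_eq_zero_iff] at hllen
      rw [hllen, List.prod_nil] at hlprod
      have h1 := Fin.partialProd_right_inv t.1 i
      rw [← hlprod, inv_mul_eq_one] at h1
      have h2 := congrArg (absLength S) h1
      rw [hlen, hlen] at h2
      simp at h2
    rw [List.length_singleton] at hle
    rw [absLe, Fin.partialProd_right_inv, hlen, hlen]
    simp only [Fin.val_castSucc, Fin.val_succ]
    omega
  · exact hlength t.1 t.2.1 t.2.2

end MaximalChains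

section CoxeterElements

variable {n : ℕ}

lemma le_apply_signedGenerator_iff {i j : Fin n} (hij : j ≠ i) (k : Fin n) :
    (signedGenerator j).right k ≤ i ↔ k ≤ i := by
  change Equiv.swap j _ k ≤ i ↔ k ≤ i
  have hne : (j : ℕ) ≠ i := fun h => hij (Fin.ext h)
  rw [Equiv.swap_apply_def]
  split_ifs with h1 h2
  · subst h1
    simp only [Fin.le_def]
    omega
  · subst h2
    simp only [Fin.le_def]
    omega
  · rfl

lemma comp_signedGenerator_eq_of_prod {l : List (Fin n)} (hl : l.Nodup) (v : Fin n → ℤ)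
    (hv : ∀ k, v ((l.map fun i => (signedGenerator i).right).prod k) = v k) :
    ∀ i ∈ l, ∀ k, v ((signedGenerator i).right k) = v k := by
  induction l with
  | nil => simp
  | cons i l ih =>
    obtain ⟨hi, hl⟩ := List.nodup_cons.1 hl
    rw [List.map_cons, List.prod_cons] at hv
    set w := (l.map fun i => (signedGenerator i).right).prod with hw
    have hpres : ∀ k, w k ≤ i ↔ k ≤ i := by
      have : ∀ m : List (Fin n), i ∉ m → ∀ k,
          (m.map fun i => (signedGenerator i).right).prod k ≤ i ↔ k ≤ i := by
        intro m
        induction m with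
        | nil => simp
        | cons j m ihm =>
          intro hm k
          rw [List.mem_cons, not_or] at hm
          rw [List.map_cons, List.prod_cons, Equiv.Perm.mul_apply,
            le_apply_signedGenerator_iff (Ne.symm hm.1), ihm hm.2]
      exact this l hi
    have hsum : ∑ k ∈ Finset.Iic i, v ((signedGenerator i).right k) =
        ∑ k ∈ Finset.Iic i, v k := by
      rw [← Finset.sum_congr rfl fun k _ => hv k]
      refine (Finset.sum_equiv w (fun k => ?_) fun k _ => rfl).symm
      rw [Finset.mem_Iic, Finset.mem_Iic, hpres]
    have hfix : ∀ k, v ((signedGenerator i).right k) = v k := by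
      by_cases hlast : (i : ℕ) + 1 < n
      · rw [signedGenerator_of_lt hlast, SemidirectProduct.right_inr] at hsum ⊢
        have hmem : i ∈ Finset.Iic i := Finset.mem_Iic.2 le_rfl
        rw [← Finset.add_sum_erase _ _ hmem, ← Finset.add_sum_erase _ _ hmem,
          Equiv.swap_apply_left] at hsum
        have hrest : ∑ k ∈ (Finset.Iic i).erase i, v (Equiv.swap i ⟨i + 1, hlast⟩ k) =
            ∑ k ∈ (Finset.Iic i).erase i, v k := by
          refine Finset.sum_congr rfl fun k hk => ?_
          rw [Finset.mem_erase, Finset.mem_Iic] at hk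
          rw [Equiv.swap_apply_of_ne_of_ne hk.1]
          rintro rfl
          have := Fin.le_def.1 hk.2
          simp at this
        rw [hrest, add_left_inj] at hsum
        intro k
        rw [Equiv.swap_apply_def]
        split_ifs with h1 h2
        · rw [h1, hsum]
        · rw [h2, hsum]
        · rfl
      · rw [signedGenerator_last hlast, SemidirectProduct.right_inl]
        exact fun _ => rfl
    intro j hj
    rcases List.mem_cons.1 hj with rfl | hj
    · exact hfix
    · refine ih hl (fun k => ?_) j hj
      rw [← hfix, ← Equiv.Perm.mul_apply, hv]

lemma signProduct_signedGenerator (i : Fin n) :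
    signProduct (signedGenerator i) = if (i : ℕ) + 1 < n then 1 else -1 := by
  split_ifs with h
  · rw [signedGenerator_of_lt h]
    simp [signProduct]
  · rw [signedGenerator_last h]
    exact prod_signFlip i

lemma isNegativeCycle_of_nodup (hn : 2 ≤ n) {l : List (Fin n)} (hl : l.Nodup)
    (hmem : ∀ i, i ∈ l) : IsNegativeCycle (l.map signedGenerator).prod := by
  constructor
  · have hright : (l.map signedGenerator).prod.right =
        (l.map fun i => (signedGenerator i).right).prod := by
      have := map_list_prod (SemidirectProduct.rightHom (N := Fin n → ℤˣ) (φ := mulAutArrow))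
        (l.map signedGenerator)
      rw [List.map_map] at this
      exact this
    rw [hright]
    refine cycleType_of_forall_invariant hn _ fun s hs hne => ?_
    classical
    have hstep : ∀ i : Fin n, ∀ h : (i : ℕ) + 1 < n, (⟨i + 1, h⟩ : Fin n) ∈ s ↔ i ∈ s := by
      intro i h
      have := comp_signedGenerator_eq_of_prod hl (s.indicator 1)
        (fun k => by simp only [Set.indicator_apply, hs, Pi.one_apply]) i (hmem i) i
      rw [signedGenerator_of_lt h, SemidirectProduct.right_inr, Equiv.swap_apply_left] at this
      simp only [Set.indicator_apply, Pi.one_apply] at this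
      split_ifs at this with h1 h2 <;> simp_all
    have hzero : ∀ k (hk : k < n), (⟨k, hk⟩ : Fin n) ∈ s ↔ (⟨0, by omega⟩ : Fin n) ∈ s := by
      intro k
      induction k with
      | zero => exact fun _ => Iff.rfl
      | succ k ih => exact fun hk => (hstep ⟨k, by omega⟩ hk).trans (ih (by omega))
    obtain ⟨i, hi⟩ := hne
    exact Set.eq_univ_of_forall fun j => (hzero j j.2).2 ((hzero i i.2).1 hi)
  · have huniv : l.toFinset = Finset.univ :=
      Finset.eq_univ_iff_forall.2 fun i => List.mem_toFinset.2 (hmem i)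
    rw [map_list_prod, List.map_map, ← List.prod_toFinset _ hl, huniv,
      Finset.prod_eq_single (⟨n - 1, by omega⟩ : Fin n)]
    · rw [Function.comp_apply, signProduct_signedGenerator, if_neg (by simp only; omega)]
    · intro i _ hi
      have : (i : ℕ) ≠ n - 1 := fun h => hi (Fin.ext h)
      rw [Function.comp_apply, signProduct_signedGenerator, if_pos (by omega)]
    · simp

lemma typeBRelations_simple {W : Type*} [Group W] {M : CoxeterMatrix (Fin n)}
    (cs : CoxeterSystem M W) (hn : 0 < n)
    (hM : ∀ i j : Fin n, M i j =
      if i = j then 1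
      else if (i : ℕ) + 1 = (j : ℕ) ∨ (j : ℕ) + 1 = (i : ℕ) then
        (if (i : ℕ) = n - 1 ∨ (j : ℕ) = n - 1 then 4 else 3)
      else 2) :
    TypeBRelations (fun k => cs.simple ⟨n - 1 - k, by omega⟩) n := by
  have hrel := fun i j : ℕ =>
    cs.simple_mul_simple_pow ⟨n - 1 - i, by omega⟩ ⟨n - 1 - j, by omega⟩
  simp only [hM, Fin.mk.injEq] at hrel
  have hinv : ∀ x y : Fin n, (cs.simple x * cs.simple y)⁻¹ = cs.simple y * cs.simple x := by
    intro x y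
    rw [mul_inv_rev, cs.inv_simple, cs.inv_simple]
  refine ⟨fun i _ => cs.simple_mul_simple_self _, fun i hi j hj hij => ?_, fun i h1 hi => ?_,
    fun h1 => ?_⟩
  · have := hrel i j
    rw [if_neg (by omega), if_neg (by omega), pow_two] at this
    exact (eq_inv_of_mul_eq_one_left this).trans (hinv _ _)
  · have := hrel i (i + 1)
    rw [if_neg (by omega), if_pos (by omega), if_neg (by omega), pow_succ, pow_two] at this
    have h2 := eq_inv_of_mul_eq_one_left
      (a := cs.simple ⟨n - 1 - i, by omega⟩ * cs.simple ⟨n - 1 - (i + 1), by omega⟩ *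
        cs.simple ⟨n - 1 - i, by omega⟩)
      (b := cs.simple ⟨n - 1 - (i + 1), by omega⟩ * cs.simple ⟨n - 1 - i, by omega⟩ *
        cs.simple ⟨n - 1 - (i + 1), by omega⟩) (by simpa only [mul_assoc] using this)
    rw [mul_inv_rev, hinv, cs.inv_simple, ← mul_assoc] at h2
    exact h2
  · have := hrel 0 1
    rw [if_neg (by omega), if_pos (by omega), if_pos (by omega), show 4 = 2 + 2 from rfl, pow_add,
      pow_two] at this
    have h2 := eq_inv_of_mul_eq_one_left this
    rw [mul_inv_rev, hinv] at h2
    simpa only [mul_assoc] using h2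

lemma exists_mulEquiv_signedPerm {W : Type*} [Group W] [Finite W] {M : CoxeterMatrix (Fin n)}
    (cs : CoxeterSystem M W) (hn : 0 < n)
    (hM : ∀ i j : Fin n, M i j =
      if i = j then 1
      else if (i : ℕ) + 1 = (j : ℕ) ∨ (j : ℕ) + 1 = (i : ℕ) then
        (if (i : ℕ) = n - 1 ∨ (j : ℕ) = n - 1 then 4 else 3)
      else 2) :
    ∃ e : W ≃* SignedPerm n, ∀ i, e (cs.simple i) = signedGenerator i := by
  let f : W →* SignedPerm n := cs.lift ⟨signedGenerator, signedGenerator_isLiftable hM⟩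
  have hf : ∀ i, f (cs.simple i) = signedGenerator i :=
    cs.lift_apply_simple (signedGenerator_isLiftable hM)
  have hsurj : Function.Surjective f := by
    rw [← MonoidHom.range_eq_top, eq_top_iff, ← closure_range_signedGenerator,
      Subgroup.closure_le]
    rintro _ ⟨i, rfl⟩
    exact ⟨_, hf i⟩
  have hcard : Nat.card W ≤ Nat.card (SignedPerm n) := by
    have htop : Subgroup.closure
        ((fun k => cs.simple (⟨n - 1 - k, by omega⟩ : Fin n)) '' Set.Iio n) = ⊤ := by
      rw [← cs.subgroup_closure_range_simple]
      congr 1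
      ext x
      constructor
      · rintro ⟨k, _, rfl⟩
        exact ⟨_, rfl⟩
      · rintro ⟨i, rfl⟩
        refine ⟨n - 1 - i, by simp only [Set.mem_Iio]; omega, ?_⟩
        exact congrArg cs.simple (Fin.ext (by simp only; omega))
    refine ((typeBRelations_simple cs hn hM).card_le htop).trans_eq ?_
    rw [Nat.card_congr SemidirectProduct.equivProd, Nat.card_prod]
    simp [Nat.card_eq_fintype_card, Fintype.card_perm]
  exact ⟨MulEquiv.ofBijective f (hsurj.bijective_of_nat_card_le hcard), hf⟩

end CoxeterElements

/-- **Type `Bₙ` maximal chains.**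
Let `n ≥ 2` and let `(W,S)` be a finite Coxeter system whose Coxeter matrix (indexed by
`Fin n`, with `sᵢ` corresponding to `i - 1`) is of type `Bₙ`: the order of `sᵢsᵢ₊₁` is `3`
for `1 ≤ i ≤ n−2`, the order of `sₙ₋₁sₙ` is `4`, and `sᵢ`, `sⱼ` commute for `|i−j| ≥ 2`.
Then the number of maximal chains in the noncrossing partition lattice `L_W` is `nⁿ`. -/
theorem typeB_max_chain_count
    (n : ℕ) (hn : 2 ≤ n) {W : Type} [Group W] [Fintype W]
    {M : CoxeterMatrix (Fin n)} (cs : CoxeterSystem M W)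
    (hM : ∀ i j : Fin n, M i j =
      if i = j then 1
      else if (i : ℕ) + 1 = (j : ℕ) ∨ (j : ℕ) + 1 = (i : ℕ) then
        (if (i : ℕ) = n - 1 ∨ (j : ℕ) = n - 1 then 4 else 3)
      else 2)
    (c : W) (hc : IsCoxeterElementOf (simpleSet cs) c) :
    maxChainCount (simpleSet cs) c n = n ^ n := by
  obtain ⟨e, he⟩ := exists_mulEquiv_signedPerm cs (by omega) hM
  have hrefl : ∀ x, IsReflectionOf (simpleSet cs) x ↔ e x ∈ Set.range signedReflection := by
    intro x
    constructor
    · rintro ⟨g, _, ⟨i, rfl⟩, rfl⟩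
      rw [map_mul, map_mul, map_inv, conj_mem_range_signedReflection_iff, he]
      exact ⟨_, rfl⟩
    · rintro ⟨p, hp⟩
      obtain ⟨i, hi⟩ := exists_conj_signedGenerator hn p
      obtain ⟨g, hg⟩ := isConj_iff.1 hi
      refine ⟨e.symm g, cs.simple i, ⟨i, rfl⟩, e.injective ?_⟩
      rw [map_mul, map_mul, map_inv, he, e.apply_symm_apply, hg, hp]
  have hneg : IsNegativeCycle (e c) := by
    obtain ⟨l, hnodup, hmem, rfl⟩ := hc
    have hinj : Function.Injective cs.simple := by
      intro i j h
      apply signedGenerator_injective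
      rw [← he, ← he, h]
    obtain ⟨L, rfl⟩ : l ∈ Set.range (List.map cs.simple) := by
      rw [Set.range_list_map]
      exact fun x hx => (hmem x).1 hx
    have hmap : e (L.map cs.simple).prod = (L.map signedGenerator).prod := by
      rw [map_list_prod, List.map_map]
      congr 2
      funext i
      exact he i
    rw [hmap]
    refine isNegativeCycle_of_nodup hn hnodup.of_map fun i => ?_
    obtain ⟨j, hj, hji⟩ := List.mem_map.1 ((hmem (cs.simple i)).2 ⟨i, rfl⟩)
    rwa [← hinj hji]
  have hshort : ∀ l : List W, (∀ t ∈ l, IsReflectionOf (simpleSet cs) t) → l.prod = c →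
      n ≤ l.length := by
    rintro l hl rfl
    by_contra hlt
    obtain ⟨L, hL⟩ : l.map e ∈ Set.range (List.map signedReflection) := by
      rw [Set.range_list_map]
      intro x hx
      obtain ⟨t, ht, rfl⟩ := List.mem_map.1 hx
      exact (hrefl t).1 (hl t ht)
    have hlen : L.length = l.length := by simpa using congrArg List.length hL
    refine not_isNegativeCycle_prod hn (k := L.length) (by omega) L.get ?_
    have hofFn : (List.ofFn fun i => signedReflection (L.get i)) = L.map signedReflection := by
      conv_rhs => rw [← List.ofFn_get L, List.map_ofFn]
      rfl
    rwa [hofFn, hL, ← map_list_prod]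
  rw [maxChainCount_eq_card_factorizations hshort,
    card_factorizations_mulEquiv e _ (fun x => x ∈ Set.range signedReflection) hrefl,
    card_factorizations_of_isNegativeCycle hn hneg]
end
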